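/- arXiv:1510.01826 — 2 statements merged into one kernel-verified Lean document; each statement's English description precedes it below -/
import Mathlib

section
/- (Main theorem) Let H be a finite dimensional C*-Hopf algebra with dual C*-Hopf algebra H^0, and let ρ and σ be coactions of H^0 on unital C*-algebras A and B, respectively. If ρ is strongly Morita equivalent to σ, then ρ has the Rohlin property if and only if σ has the Rohlin property. -/
open scoped TensorProduct
open Filter Topology
set_option maxHeartbeats 1000000
set_option linter.unusedSectionVars false
set_option synthInstance.maxHeartbeats 400000
noncomputable section
namespace SMEPaper
universe u

/-! ### Generalities on tensor products with a finite dimensional C*-algebra -/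

/-- Contraction of the right tensor factor against a linear functional:
`appRight f (m ⊗ c) = f c • m`. -/
def appRight {M C : Type*} [AddCommGroup M] [Module ℂ M] [AddCommGroup C] [Module ℂ C]
    (f : C →ₗ[ℂ] ℂ) : M ⊗[ℂ] C →ₗ[ℂ] M :=
  (TensorProduct.rid ℂ M).toLinearMap ∘ₗ TensorProduct.map LinearMap.id f

/-- The `i`-th coordinate, with respect to the canonical finite basis of `C`, of an
element of `M ⊗[ℂ] C`. -/
def tcoord {M C : Type*} [AddCommGroup M] [Module ℂ M] [AddCommGroup C] [Module ℂ C]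
    [FiniteDimensional ℂ C] (i : Fin (Module.finrank ℂ C)) : M ⊗[ℂ] C →ₗ[ℂ] M :=
  appRight ((Module.finBasis ℂ C).coord i)

/-- The star operation on `M ⊗[ℂ] C` (`C` finite dimensional) where the star operation on the
first factor is supplied as a function: on simple tensors, `m ⊗ c ↦ sM m ⊗ star c`. -/
def tstarWith {M C : Type*} [AddCommGroup M] [Module ℂ M] [Ring C] [Algebra ℂ C]
    [StarRing C] [FiniteDimensional ℂ C] (sM : M → M) (t : M ⊗[ℂ] C) : M ⊗[ℂ] C :=
  ∑ i, sM (tcoord i t) ⊗ₜ star (Module.finBasis ℂ C i)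

/-- Combination of an operation on the first factors and an operation on the second (finite
dimensional) factors to an operation on tensor products: on simple tensors,
`tmix op cop (p ⊗ c) (q ⊗ d) = op p q ⊗ cop c d`. -/
def tmix {P Q R C : Type*} [AddCommGroup P] [Module ℂ P] [AddCommGroup Q] [Module ℂ Q]
    [AddCommGroup R] [Module ℂ R] [Ring C] [Algebra ℂ C] [FiniteDimensional ℂ C]
    (op : P → Q → R) (cop : C → C → C) (s : P ⊗[ℂ] C) (t : Q ⊗[ℂ] C) : R ⊗[ℂ] C :=
  ∑ i, ∑ j,
    op (tcoord i s) (tcoord j t) ⊗ₜ cop (Module.finBasis ℂ C i) (Module.finBasis ℂ C j)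

/-- The operation on tensor products induced by an operation on the first factors (and
multiplication in the second): `tact op (p ⊗ c) (q ⊗ d) = op p q ⊗ (c * d)`. -/
def tact {P Q R C : Type*} [AddCommGroup P] [Module ℂ P] [AddCommGroup Q] [Module ℂ Q]
    [AddCommGroup R] [Module ℂ R] [Ring C] [Algebra ℂ C] [FiniteDimensional ℂ C]
    (op : P → Q → R) : P ⊗[ℂ] C → Q ⊗[ℂ] C → R ⊗[ℂ] C :=
  tmix op (· * ·)

/-- The left inner product on `X ⊗ C` induced by a left (`A`-valued) inner product on `X`:
`(x ⊗ c), (y ⊗ d) ↦ inn x y ⊗ (c * star d)`. -/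
def tinnL {X A C : Type*} [AddCommGroup X] [Module ℂ X] [AddCommGroup A] [Module ℂ A]
    [Ring C] [Algebra ℂ C] [StarRing C] [FiniteDimensional ℂ C]
    (inn : X → X → A) : X ⊗[ℂ] C → X ⊗[ℂ] C → A ⊗[ℂ] C :=
  tmix inn (fun c d => c * star d)

/-- The right inner product on `X ⊗ C` induced by a right (`B`-valued) inner product on `X`:
`(x ⊗ c), (y ⊗ d) ↦ inn x y ⊗ (star c * d)`. -/
def tinnR {X B C : Type*} [AddCommGroup X] [Module ℂ X] [AddCommGroup B] [Module ℂ B]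
    [Ring C] [Algebra ℂ C] [StarRing C] [FiniteDimensional ℂ C]
    (inn : X → X → B) : X ⊗[ℂ] C → X ⊗[ℂ] C → B ⊗[ℂ] C :=
  tmix inn (fun c d => star c * d)

/-! ### Finite dimensional C*-Hopf algebras -/

/-- The data and axioms of a finite dimensional C*-Hopf algebra structure on the finite
dimensional C*-algebra `H0`: a comultiplication, counit and antipode satisfying the Hopf
algebra axioms, compatibly with the ⋆-structure. -/
structure HopfAlgData (H0 : Type u) [Ring H0] [Algebra ℂ H0] [StarRing H0]
    [StarModule ℂ H0] [FiniteDimensional ℂ H0] where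
  comul : H0 →ₐ[ℂ] H0 ⊗[ℂ] H0
  counit : H0 →ₐ[ℂ] ℂ
  antipode : H0 →ₗ[ℂ] H0
  coassoc : ∀ h, TensorProduct.map comul.toLinearMap LinearMap.id (comul h)
      = (TensorProduct.assoc ℂ H0 H0 H0).symm
          (TensorProduct.map LinearMap.id comul.toLinearMap (comul h))
  counit_left : ∀ h,
      (TensorProduct.lid ℂ H0) (TensorProduct.map counit.toLinearMap LinearMap.id (comul h)) = h
  counit_right : ∀ h, appRight counit.toLinearMap (comul h) = h
  antipode_left : ∀ (h : H0) (n : ℕ) (h1 h2 : Fin n → H0),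
      comul h = ∑ i, h1 i ⊗ₜ h2 i → ∑ i, antipode (h1 i) * h2 i = counit h • 1
  antipode_right : ∀ (h : H0) (n : ℕ) (h1 h2 : Fin n → H0),
      comul h = ∑ i, h1 i ⊗ₜ h2 i → ∑ i, h1 i * antipode (h2 i) = counit h • 1
  comul_star : ∀ h, comul (star h) = tstarWith star (comul h)
  counit_star : ∀ h, counit (star h) = starRingEnd ℂ (counit h)

/-! ### Coactions on C*-algebras -/

section Coaction
variable {H0 : Type u} [Ring H0] [Algebra ℂ H0] [StarRing H0] [StarModule ℂ H0]
  [FiniteDimensional ℂ H0]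
variable {A B X : Type u} [Ring A] [Algebra ℂ A] [StarRing A]
  [Ring B] [Algebra ℂ B] [StarRing B] [AddCommGroup X] [Module ℂ X]

/-- `ρ : A → A ⊗ H0` is a weak coaction of `H0` (with counit `ε0`) on `A`:
a unital ⋆-homomorphism with `(id ⊗ ε0) ∘ ρ = id`. -/
structure IsWeakCoaction (ε0 : H0 →ₗ[ℂ] ℂ) (ρ : A →ₗ[ℂ] A ⊗[ℂ] H0) : Prop where
  map_one : ρ 1 = 1
  map_mul : ∀ a b, ρ (a * b) = ρ a * ρ b
  map_star : ∀ a, ρ (star a) = tstarWith star (ρ a)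
  counital : ∀ a, appRight ε0 (ρ a) = a

/-- `ρ : A → A ⊗ H0` is a coaction of `H0` (with comultiplication `Δ0`, counit `ε0`) on `A`:
a weak coaction with `(ρ ⊗ id) ∘ ρ = (id ⊗ Δ0) ∘ ρ`. -/
structure IsCoaction (Δ0 : H0 →ₗ[ℂ] H0 ⊗[ℂ] H0) (ε0 : H0 →ₗ[ℂ] ℂ)
    (ρ : A →ₗ[ℂ] A ⊗[ℂ] H0) extends IsWeakCoaction ε0 ρ : Prop where
  coassoc : ∀ a, TensorProduct.map ρ LinearMap.id (ρ a)
      = (TensorProduct.assoc ℂ A H0 H0).symm (TensorProduct.map LinearMap.id Δ0 (ρ a))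

/-- The pair `(ρ, u)` is a twisted coaction of `H0` on `A`. -/
structure IsTwistedCoaction (Δ0 : H0 →ₗ[ℂ] H0 ⊗[ℂ] H0) (ε0 : H0 →ₗ[ℂ] ℂ)
    (ρ : A →ₗ[ℂ] A ⊗[ℂ] H0) (u : (A ⊗[ℂ] H0) ⊗[ℂ] H0)
    extends IsWeakCoaction ε0 ρ : Prop where
  unitary_left : u * tstarWith (tstarWith star) u = 1
  unitary_right : tstarWith (tstarWith star) u * u = 1
  twisted_coassoc : ∀ a, TensorProduct.map ρ LinearMap.id (ρ a)
      = u * ((TensorProduct.assoc ℂ A H0 H0).symm (TensorProduct.map LinearMap.id Δ0 (ρ a)))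
        * tstarWith (tstarWith star) u
  cocycle : (u ⊗ₜ (1 : H0))
        * TensorProduct.map ((TensorProduct.assoc ℂ A H0 H0).symm.toLinearMap
            ∘ₗ TensorProduct.map LinearMap.id Δ0) LinearMap.id u
      = TensorProduct.map (TensorProduct.map ρ LinearMap.id) LinearMap.id u
        * (TensorProduct.assoc ℂ (A ⊗[ℂ] H0) H0 H0).symm
            (TensorProduct.map LinearMap.id Δ0 u)
  counit_mid : ∀ h : Module.Dual ℂ H0, appRight h (appRight ε0 u) = h 1 • (1 : A)
  counit_out : ∀ h : Module.Dual ℂ H0, appRight ε0 (appRight h u) = h 1 • (1 : A)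

/-- The trivial coaction `a ↦ a ⊗ 1` of `H0` on `A`. -/
def trivialCoaction (H0 : Type u) [Ring H0] [Algebra ℂ H0] (A : Type u) [Ring A]
    [Algebra ℂ A] : A →ₗ[ℂ] A ⊗[ℂ] H0 :=
  (TensorProduct.mk ℂ A H0).flip 1

end Coaction

/-! ### Hilbert bimodules -/

/-- A (pre-)Hilbert `A`–`B` bimodule structure on `X`: a bimodule with a left `A`-valued and a
right `B`-valued inner product, compatible with the module actions, with the appropriate
(conjugate-)linearity, symmetry, positivity and definiteness properties. -/
structure Bimod (A B X : Type u) [Ring A] [Algebra ℂ A] [StarRing A]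
    [Ring B] [Algebra ℂ B] [StarRing B] [AddCommGroup X] [Module ℂ X] where
  ls : A → X → X
  rs : X → B → X
  linn : X → X → A
  rinn : X → X → B
  ls_one : ∀ x, ls 1 x = x
  ls_mul : ∀ a a' x, ls (a * a') x = ls a (ls a' x)
  ls_add : ∀ a a' x, ls (a + a') x = ls a x + ls a' x
  ls_add' : ∀ a x y, ls a (x + y) = ls a x + ls a y
  ls_smul : ∀ (c : ℂ) a x, ls (c • a) x = c • ls a x
  ls_smul' : ∀ (c : ℂ) a x, ls a (c • x) = c • ls a x
  rs_one : ∀ x, rs x 1 = x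
  rs_mul : ∀ x b b', rs x (b * b') = rs (rs x b) b'
  rs_add : ∀ x b b', rs x (b + b') = rs x b + rs x b'
  rs_add' : ∀ x y b, rs (x + y) b = rs x b + rs y b
  rs_smul : ∀ (c : ℂ) x b, rs x (c • b) = c • rs x b
  rs_smul' : ∀ (c : ℂ) x b, rs (c • x) b = c • rs x b
  ls_rs : ∀ a x b, ls a (rs x b) = rs (ls a x) b
  linn_add_left : ∀ x y z, linn (x + y) z = linn x z + linn y z
  linn_add_right : ∀ x y z, linn x (y + z) = linn x y + linn x z
  rinn_add_left : ∀ x y z, rinn (x + y) z = rinn x z + rinn y z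
  rinn_add_right : ∀ x y z, rinn x (y + z) = rinn x y + rinn x z
  linn_smul_left : ∀ (c : ℂ) x y, linn (c • x) y = c • linn x y
  linn_smul_right : ∀ (c : ℂ) x y, linn x (c • y) = starRingEnd ℂ c • linn x y
  rinn_smul_left : ∀ (c : ℂ) x y, rinn (c • x) y = starRingEnd ℂ c • rinn x y
  rinn_smul_right : ∀ (c : ℂ) x y, rinn x (c • y) = c • rinn x y
  linn_star : ∀ x y, star (linn x y) = linn y x
  rinn_star : ∀ x y, star (rinn x y) = rinn y x
  linn_ls : ∀ a x y, linn (ls a x) y = a * linn x y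
  rinn_rs : ∀ x y b, rinn x (rs y b) = rinn x y * b
  linn_rs : ∀ x y b, linn (rs x b) y = linn x (rs y (star b))
  rinn_ls : ∀ a x y, rinn (ls a x) y = rinn x (ls (star a) y)
  linn_pos : ∀ x, ∃ a, linn x x = star a * a
  rinn_pos : ∀ x, ∃ b, rinn x x = star b * b
  rinn_def : ∀ x, rinn x x = 0 → x = 0

section BimodDefs
variable {A B X : Type u} [Ring A] [Algebra ℂ A] [StarRing A]
    [Ring B] [Algebra ℂ B] [StarRing B] [AddCommGroup X] [Module ℂ X]

/-- A Hilbert bimodule is of finite type if it admits a finite right basis and a finite left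
basis in the sense of Kajiwara–Watatani. -/
def Bimod.FiniteType (bm : Bimod A B X) : Prop :=
  (∃ (n : ℕ) (u : Fin n → X), ∀ x, ∑ i, bm.rs (u i) (bm.rinn (u i) x) = x) ∧
  (∃ (m : ℕ) (v : Fin m → X), ∀ x, ∑ j, bm.ls (bm.linn x (v j)) (v j) = x)

/-- An equivalence bimodule: both inner products are full and the associativity condition
`_A⟨x,y⟩ • z = x • ⟨y,z⟩_B` holds. -/
def Bimod.IsEquivalence (bm : Bimod A B X) : Prop :=
  (∀ x y z, bm.ls (bm.linn x y) z = bm.rs x (bm.rinn y z)) ∧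
  Submodule.span ℂ (Set.range fun p : X × X => bm.linn p.1 p.2) = ⊤ ∧
  Submodule.span ℂ (Set.range fun p : X × X => bm.rinn p.1 p.2) = ⊤

end BimodDefs

/-! ### Coactions on Hilbert bimodules, covariant systems, strong Morita equivalence -/

section BimodCoaction
variable {H0 : Type u} [Ring H0] [Algebra ℂ H0] [StarRing H0] [StarModule ℂ H0]
  [FiniteDimensional ℂ H0]
variable {A B X : Type u} [Ring A] [Algebra ℂ A] [StarRing A]
  [Ring B] [Algebra ℂ B] [StarRing B] [AddCommGroup X] [Module ℂ X]

/-- `(A, B, X, ρ, σ, λ, H0)` is a weak covariant system: `lam` is a weak coaction of `H0` on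
the Hilbert `A`–`B` bimodule `X` with respect to `(A, B, ρ, σ)`. -/
structure IsWeakCoactionBimod (ε0 : H0 →ₗ[ℂ] ℂ) (bm : Bimod A B X)
    (ρ : A →ₗ[ℂ] A ⊗[ℂ] H0) (σ : B →ₗ[ℂ] B ⊗[ℂ] H0)
    (lam : X →ₗ[ℂ] X ⊗[ℂ] H0) : Prop where
  ls_compat : ∀ a x, lam (bm.ls a x) = tact bm.ls (ρ a) (lam x)
  rs_compat : ∀ x b, lam (bm.rs x b) = tact bm.rs (lam x) (σ b)
  linn_compat : ∀ x y, ρ (bm.linn x y) = tinnL bm.linn (lam x) (lam y)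
  rinn_compat : ∀ x y, σ (bm.rinn x y) = tinnR bm.rinn (lam x) (lam y)
  counital : ∀ x, appRight ε0 (lam x) = x

/-- `(A, B, X, ρ, σ, λ, H0)` is a covariant system: `lam` is a coaction of `H0` on the
Hilbert `A`–`B` bimodule `X` with respect to `(A, B, ρ, σ)`. -/
structure IsCoactionBimod (Δ0 : H0 →ₗ[ℂ] H0 ⊗[ℂ] H0) (ε0 : H0 →ₗ[ℂ] ℂ) (bm : Bimod A B X)
    (ρ : A →ₗ[ℂ] A ⊗[ℂ] H0) (σ : B →ₗ[ℂ] B ⊗[ℂ] H0) (lam : X →ₗ[ℂ] X ⊗[ℂ] H0)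
    extends IsWeakCoactionBimod ε0 bm ρ σ lam : Prop where
  coassoc : ∀ x, TensorProduct.map lam LinearMap.id (lam x)
      = (TensorProduct.assoc ℂ X H0 H0).symm (TensorProduct.map LinearMap.id Δ0 (lam x))

/-- `(A, B, X, ρ, u, σ, v, λ, H0)` is a twisted covariant system: `lam` is a twisted coaction
of `H0` on the Hilbert `A`–`B` bimodule `X` with respect to `(A, B, ρ, u, σ, v)`. -/
structure IsTwistedCoactionBimod (Δ0 : H0 →ₗ[ℂ] H0 ⊗[ℂ] H0) (ε0 : H0 →ₗ[ℂ] ℂ)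
    (bm : Bimod A B X) (ρ : A →ₗ[ℂ] A ⊗[ℂ] H0) (u : (A ⊗[ℂ] H0) ⊗[ℂ] H0)
    (σ : B →ₗ[ℂ] B ⊗[ℂ] H0) (v : (B ⊗[ℂ] H0) ⊗[ℂ] H0) (lam : X →ₗ[ℂ] X ⊗[ℂ] H0)
    extends IsWeakCoactionBimod ε0 bm ρ σ lam : Prop where
  twisted : ∀ x, TensorProduct.map lam LinearMap.id (lam x)
      = tact (tact bm.rs)
          (tact (tact bm.ls) u
            ((TensorProduct.assoc ℂ X H0 H0).symm (TensorProduct.map LinearMap.id Δ0 (lam x))))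
          (tstarWith (tstarWith star) v)

/-- Two weak coactions `ρ` (on `A`) and `σ` (on `B`) of `H0` are strongly Morita equivalent
if there are an `A`–`B` equivalence bimodule `X` and a weak coaction of `H0` on `X` with
respect to `(A, B, ρ, σ)`. -/
def WeakSME (ε0 : H0 →ₗ[ℂ] ℂ) (ρ : A →ₗ[ℂ] A ⊗[ℂ] H0) (σ : B →ₗ[ℂ] B ⊗[ℂ] H0) : Prop :=
  ∃ (X : Type u) (_ : AddCommGroup X) (_ : Module ℂ X) (bm : Bimod A B X),
    bm.IsEquivalence ∧ ∃ lam : X →ₗ[ℂ] X ⊗[ℂ] H0, IsWeakCoactionBimod ε0 bm ρ σ lam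

/-- Two coactions `ρ` (on `A`) and `σ` (on `B`) of `H0` are strongly Morita equivalent if
there are an `A`–`B` equivalence bimodule `X` and a coaction of `H0` on `X` with respect to
`(A, B, ρ, σ)`. -/
def CoactSME (Δ0 : H0 →ₗ[ℂ] H0 ⊗[ℂ] H0) (ε0 : H0 →ₗ[ℂ] ℂ)
    (ρ : A →ₗ[ℂ] A ⊗[ℂ] H0) (σ : B →ₗ[ℂ] B ⊗[ℂ] H0) : Prop :=
  ∃ (X : Type u) (_ : AddCommGroup X) (_ : Module ℂ X) (bm : Bimod A B X),
    bm.IsEquivalence ∧ ∃ lam : X →ₗ[ℂ] X ⊗[ℂ] H0, IsCoactionBimod Δ0 ε0 bm ρ σ lam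

/-- Two twisted coactions `(ρ, u)` (on `A`) and `(σ, v)` (on `B`) of `H0` are strongly Morita
equivalent if there are an `A`–`B` equivalence bimodule `X` and a twisted coaction of `H0` on
`X` with respect to `(A, B, ρ, u, σ, v)`. -/
def TwistedSME (Δ0 : H0 →ₗ[ℂ] H0 ⊗[ℂ] H0) (ε0 : H0 →ₗ[ℂ] ℂ)
    (ρ : A →ₗ[ℂ] A ⊗[ℂ] H0) (u : (A ⊗[ℂ] H0) ⊗[ℂ] H0)
    (σ : B →ₗ[ℂ] B ⊗[ℂ] H0) (v : (B ⊗[ℂ] H0) ⊗[ℂ] H0) : Prop :=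
  ∃ (X : Type u) (_ : AddCommGroup X) (_ : Module ℂ X) (bm : Bimod A B X),
    bm.IsEquivalence ∧
      ∃ lam : X →ₗ[ℂ] X ⊗[ℂ] H0, IsTwistedCoactionBimod Δ0 ε0 bm ρ u σ v lam

end BimodCoaction
/-! ### A finite dimensional C*-Hopf algebra together with its dual -/

/-- A finite dimensional C*-Hopf algebra `H` together with its dual C*-Hopf algebra `H0`:
Hopf algebra structures on both, a perfect pairing compatible with all the structure, and
the distinguished (Haar) projections `e ∈ H` and `τ ∈ H0`. -/
structure HopfPairData (H H0 : Type u) [Ring H] [Algebra ℂ H] [StarRing H] [StarModule ℂ H]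
    [FiniteDimensional ℂ H] [Ring H0] [Algebra ℂ H0] [StarRing H0] [StarModule ℂ H0]
    [FiniteDimensional ℂ H0] where
  dH : HopfAlgData H
  dH0 : HopfAlgData H0
  pair : H →ₗ[ℂ] H0 →ₗ[ℂ] ℂ
  perfect : Function.Bijective fun h => pair h
  perfect' : Function.Bijective fun φ => pair.flip φ
  pair_mul_left : ∀ (h l : H) (φ : H0) (n : ℕ) (φ1 φ2 : Fin n → H0),
      dH0.comul φ = ∑ i, φ1 i ⊗ₜ φ2 i →
      pair (h * l) φ = ∑ i, pair h (φ1 i) * pair l (φ2 i)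
  pair_mul_right : ∀ (h : H) (φ ψ : H0) (n : ℕ) (h1 h2 : Fin n → H),
      dH.comul h = ∑ i, h1 i ⊗ₜ h2 i →
      pair h (φ * ψ) = ∑ i, pair (h1 i) φ * pair (h2 i) ψ
  pair_one_left : ∀ φ, pair 1 φ = dH0.counit φ
  pair_one_right : ∀ h, pair h 1 = dH.counit h
  pair_antipode : ∀ h φ, pair (dH.antipode h) φ = pair h (dH0.antipode φ)
  pair_star : ∀ h φ, pair (star h) φ = starRingEnd ℂ (pair h (star (dH0.antipode φ)))
  pair_star' : ∀ h φ, pair h (star φ) = starRingEnd ℂ (pair (star (dH.antipode h)) φ)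
  haar : H
  haar_star : star haar = haar
  haar_idem : haar * haar = haar
  haar_absorb : ∀ h, h * haar = dH.counit h • haar
  haar_absorb' : ∀ h, haar * h = dH.counit h • haar
  counit_haar : dH.counit haar = 1
  haar0 : H0
  haar0_star : star haar0 = haar0
  haar0_idem : haar0 * haar0 = haar0
  haar0_absorb : ∀ φ, φ * haar0 = dH0.counit φ • haar0
  haar0_absorb' : ∀ φ, haar0 * φ = dH0.counit φ • haar0
  counit_haar0 : dH0.counit haar0 = 1

section DualAct
variable {H H0 : Type u} [Ring H] [Algebra ℂ H] [StarRing H] [StarModule ℂ H]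
    [FiniteDimensional ℂ H] [Ring H0] [Algebra ℂ H0] [StarRing H0] [StarModule ℂ H0]
    [FiniteDimensional ℂ H0]

/-- The action of `h ∈ H` on `M` induced by a coaction-type map `ρ : M → M ⊗ H0` of the
dual `H0`:  `h ·_ρ m = (id ⊗ h)(ρ m)`. -/
def coactAct {M : Type u} [AddCommGroup M] [Module ℂ M] (dp : HopfPairData H H0)
    (ρ : M →ₗ[ℂ] M ⊗[ℂ] H0) (h : H) (m : M) : M :=
  appRight (dp.pair h) (ρ m)

end DualAct

/-! ### The Rohlin property, via central sequences -/

section Rohlin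
variable {H H0 : Type u} [Ring H] [Algebra ℂ H] [StarRing H] [StarModule ℂ H]
    [FiniteDimensional ℂ H] [Ring H0] [Algebra ℂ H0] [StarRing H0] [StarModule ℂ H0]
    [FiniteDimensional ℂ H0]

/-- The Rohlin property for a coaction `ρ` of `H0` on the unital C*-algebra `A`:
there is a projection `p ∈ A_∞ = A^∞ ∩ A'` with `e ·_{ρ^∞} p = 1/N`, where `e ∈ H` is the
distinguished (Haar) projection and `N = dim H`.  Elements of `A^∞ = ℓ^∞(ℕ,A)/c₀(ℕ,A)` are
represented by bounded sequences, and equalities in the quotient unfold to norm convergence. -/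
def RohlinProperty {A : Type u} [CStarAlgebra A] (dp : HopfPairData H H0)
    (ρ : A →ₗ[ℂ] A ⊗[ℂ] H0) : Prop :=
  ∃ p : ℕ → A, (∃ M, ∀ n, ‖p n‖ ≤ M) ∧
    Tendsto (fun n => ‖star (p n) - p n‖) atTop (𝓝 0) ∧
    Tendsto (fun n => ‖p n * p n - p n‖) atTop (𝓝 0) ∧
    (∀ a : A, Tendsto (fun n => ‖p n * a - a * p n‖) atTop (𝓝 0)) ∧
    Tendsto (fun n => ‖coactAct dp ρ dp.haar (p n)
      - (((Module.finrank ℂ H : ℂ))⁻¹ • 1 : A)‖) atTop (𝓝 0)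

end Rohlin

/-! ### Tensor products with a finite dimensional algebra -/

section Tensor
variable {M N P Q R C : Type*} [AddCommGroup M] [Module ℂ M] [AddCommGroup N] [Module ℂ N]
  [AddCommGroup P] [Module ℂ P] [AddCommGroup Q] [Module ℂ Q] [AddCommGroup R] [Module ℂ R]
  [Ring C] [Algebra ℂ C]

@[simp]
lemma appRight_tmul (f : C →ₗ[ℂ] ℂ) (m : M) (c : C) : appRight f (m ⊗ₜ[ℂ] c) = f c • m := by
  simp [appRight]

lemma exists_fin_sum_tmul {D : Type*} [AddCommGroup D] [Module ℂ D] (t : M ⊗[ℂ] D) :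
    ∃ (n : ℕ) (m : Fin n → M) (c : Fin n → D), t = ∑ i, m i ⊗ₜ[ℂ] c i := by
  obtain ⟨S, rfl⟩ := TensorProduct.exists_finset t
  refine ⟨S.card, fun i => (S.equivFin.symm i).1.1, fun i => (S.equivFin.symm i).1.2, ?_⟩
  rw [← Finset.sum_coe_sort S]
  exact (Equiv.sum_comp S.equivFin.symm fun i : S => i.1.1 ⊗ₜ[ℂ] i.1.2).symm

lemma sum_appRight_coord_tmul {ι : Type*} [Fintype ι] (b : Module.Basis ι ℂ C) (t : M ⊗[ℂ] C) :
    ∑ i, appRight (b.coord i) t ⊗ₜ[ℂ] b i = t := by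
  induction t with
  | zero => simp
  | add s t hs ht => simp_rw [map_add, TensorProduct.add_tmul, Finset.sum_add_distrib, hs, ht]
  | tmul m c =>
    simp_rw [appRight_tmul, TensorProduct.smul_tmul, ← TensorProduct.tmul_sum]
    congr 1
    exact b.sum_repr c

lemma tmix_eq_map₂ [FiniteDimensional ℂ C] {τ₁ τ₂ : ℂ →+* ℂ} (op : P →ₛₗ[τ₁] Q →ₛₗ[τ₂] R)
    (cop : C →ₛₗ[τ₁] C →ₛₗ[τ₂] C) (s : P ⊗[ℂ] C) (t : Q ⊗[ℂ] C) :
    tmix (fun p q => op p q) (fun c d => cop c d) s t = TensorProduct.map₂ op cop s t := by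
  conv_rhs => rw [← sum_appRight_coord_tmul (Module.finBasis ℂ C) s,
    ← sum_appRight_coord_tmul (Module.finBasis ℂ C) t]
  simpa [tmix, tcoord, LinearMap.sum_apply] using Finset.sum_comm

lemma tact_eq_map₂ [FiniteDimensional ℂ C] (op : P →ₗ[ℂ] Q →ₗ[ℂ] R)
    (s : P ⊗[ℂ] C) (t : Q ⊗[ℂ] C) :
    tact (fun p q => op p q) s t = TensorProduct.map₂ op (LinearMap.mul ℂ C) s t :=
  tmix_eq_map₂ op (LinearMap.mul ℂ C) s t

lemma tstarWith_sum_tmul {A : Type*} [Ring A] [Algebra ℂ A] [StarRing A] [StarModule ℂ A]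
    [StarRing C] [StarModule ℂ C] [FiniteDimensional ℂ C]
    {ι : Type*} [Fintype ι] (a : ι → A) (c : ι → C) :
    tstarWith star (∑ i, a i ⊗ₜ[ℂ] c i) = ∑ i, star (a i) ⊗ₜ[ℂ] star (c i) := by
  have key : ∀ t : A ⊗[ℂ] C, tstarWith star t = TensorProduct.map
      (starLinearEquiv ℂ (A := A)).toLinearMap (starLinearEquiv ℂ (A := C)).toLinearMap t := by
    intro t
    conv_rhs => rw [← sum_appRight_coord_tmul (Module.finBasis ℂ C) t]
    simp [tstarWith, tcoord]
  simp [key]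

end Tensor

/-! ### The regular trace of a finite dimensional C*-algebra -/

section RegularTrace

lemma exists_basis_of_posDef {V : Type*} [AddCommGroup V] [Module ℂ V] [FiniteDimensional ℂ V]
    (core : InnerProductSpace.Core ℂ V) :
    ∃ b : Module.Basis (Fin (Module.finrank ℂ V)) ℂ V,
      ∀ i j, core.inner (b i) (b j) = if i = j then 1 else 0 := by
  let _ : NormedAddCommGroup V := core.toNormedAddCommGroup
  let _ : InnerProductSpace ℂ V := InnerProductSpace.ofCore core.toCore
  let b := stdOrthonormalBasis ℂ V
  refine ⟨b.toBasis, fun i j => ?_⟩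
  have := orthonormal_iff_ite.mp b.orthonormal i j
  simpa using this

variable (C : Type*) [CStarAlgebra C]

/-- The trace of the left regular representation. -/
def regularTrace : C →ₗ[ℂ] ℂ := LinearMap.trace ℂ C ∘ₗ (Algebra.lmul ℂ C).toLinearMap

variable {C}

lemma regularTrace_mul_comm (c d : C) : regularTrace C (c * d) = regularTrace C (d * c) := by
  simp only [regularTrace, LinearMap.comp_apply, AlgHom.toLinearMap_apply, map_mul]
  exact LinearMap.trace_mul_comm ℂ _ _

variable [FiniteDimensional ℂ C]

lemma spectrum_lmul (c : C) : spectrum ℂ (Algebra.lmul ℂ C c) = spectrum ℂ c := by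
  refine (AlgHom.spectrum_apply_subset (Algebra.lmul ℂ C) c).antisymm fun μ hμ => ?_
  contrapose! hμ
  rw [spectrum.notMem_iff] at hμ ⊢
  rw [← AlgHom.commutes (Algebra.lmul ℂ C), ← map_sub, Module.End.isUnit_iff] at hμ
  obtain ⟨d, hd⟩ := hμ.2 1
  refine isUnit_iff_exists.mpr ⟨d, hd, hμ.1 ?_⟩
  simpa [← mul_assoc, sub_mul] using congrArg (· * (algebraMap ℂ C μ - c)) hd

lemma regularTrace_eq_sum_roots (c : C) :
    regularTrace C c = (Algebra.lmul ℂ C c).charpoly.roots.sum :=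
  Module.End.trace_eq_sum_roots_charpoly_of_splits (IsAlgClosed.splits _)

lemma mem_roots_charpoly_lmul {c : C} {μ : ℂ} :
    μ ∈ (Algebra.lmul ℂ C c).charpoly.roots ↔ μ ∈ spectrum ℂ c := by
  rw [← spectrum_lmul, ← Module.End.hasEigenvalue_iff_mem_spectrum,
    Module.End.hasEigenvalue_iff_isRoot_charpoly,
    Polynomial.mem_roots (LinearMap.charpoly_monic _).ne_zero]

open scoped ComplexOrder

lemma nonneg_of_mem_spectrum_star_mul_self {c : C} {μ : ℂ} (h : μ ∈ spectrum ℂ (star c * c)) :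
    0 ≤ μ := by
  have hs : IsSelfAdjoint (star c * c) := .star_mul_self c
  have hr := hs.mem_spectrum_eq_re h
  rw [hr] at h ⊢
  exact_mod_cast spectrum_star_mul_self_nonneg (b := c) _
    (spectrum.algebraMap_mem_iff (R := ℝ) ℂ |>.mp h)

lemma regularTrace_star_mul_self_nonneg (c : C) : 0 ≤ regularTrace C (star c * c) := by
  rw [regularTrace_eq_sum_roots]
  exact Multiset.sum_nonneg fun μ hμ =>
    nonneg_of_mem_spectrum_star_mul_self (mem_roots_charpoly_lmul.mp hμ)

lemma eq_zero_of_regularTrace_star_mul_self {c : C} (h : regularTrace C (star c * c) = 0) :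
    c = 0 := by
  rw [regularTrace_eq_sum_roots] at h
  have hnn : ∀ μ ∈ (Algebra.lmul ℂ C (star c * c)).charpoly.roots, 0 ≤ μ := fun μ hμ =>
    nonneg_of_mem_spectrum_star_mul_self (mem_roots_charpoly_lmul.mp hμ)
  have hr := (IsSelfAdjoint.star_mul_self c).spectralRadius_eq_nnnorm
  have h0 : spectralRadius ℂ (star c * c) = 0 := by
    simp only [spectralRadius, ENNReal.iSup_eq_zero]
    intro μ hμ
    have hroot := mem_roots_charpoly_lmul.mpr hμ
    simp [le_antisymm (h ▸ Multiset.single_le_sum hnn μ hroot) (hnn μ hroot)]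
  rw [h0] at hr
  have : ‖star c * c‖₊ = 0 := by exact_mod_cast hr.symm
  exact CStarRing.star_mul_self_eq_zero_iff c |>.mp (nnnorm_eq_zero.mp this)

lemma regularTrace_star (c : C) : regularTrace C (star c) = star (regularTrace C c) := by
  have him : ∀ d : C, (regularTrace C (star d * d)).im = 0 := fun d =>
    (Complex.nonneg_iff.mp (regularTrace_star_mul_self_nonneg d)).2.symm
  have hc := him c
  have h1 := him 1
  have h2 := him (c + 1)
  have h3 := him (c + Complex.I • 1)
  simp only [star_add, star_smul, star_one, add_mul, mul_add, mul_one, one_mul, map_add,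
    smul_mul_assoc, mul_smul_comm, map_smul, smul_eq_mul, Complex.add_im, Complex.mul_im,
    Complex.star_def, Complex.conj_re, Complex.conj_im, Complex.I_re, Complex.I_im,
    Complex.mul_re] at hc h1 h2 h3
  apply Complex.ext
  · simp only [Complex.star_def, Complex.conj_re]
    linarith
  · simp only [Complex.star_def, Complex.conj_im]
    linarith

lemma exists_tracial_orthonormal_basis :
    ∃ b : Module.Basis (Fin (Module.finrank ℂ C)) ℂ C,
      ∀ i j, regularTrace C (star (b i) * b j) = if i = j then 1 else 0 := by
  refine exists_basis_of_posDef
    { inner := fun c d => regularTrace C (star c * d)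
      conj_inner_symm := fun c d => ?_
      re_inner_nonneg := fun c => (Complex.nonneg_iff.mp (regularTrace_star_mul_self_nonneg c)).1
      add_left := fun c d e => by simp [add_mul]
      smul_left := fun c d r => by simp
      definite := fun c h => eq_zero_of_regularTrace_star_mul_self h }
  change star (regularTrace C (star d * c)) = _
  rw [← regularTrace_star]
  simp

end RegularTrace

/-! ### The Nakayama automorphism of the Haar functional -/

section Hopf
variable {H0 : Type u} [Ring H0] [Algebra ℂ H0] [StarRing H0] [StarModule ℂ H0]
  [FiniteDimensional ℂ H0]

/-- The map `c ↦ star (S (star c))`, which is the inverse of the antipode `S`. -/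
def HopfAlgData.antipodeInv (d : HopfAlgData H0) : H0 →ₗ[ℂ] H0 where
  toFun c := star (d.antipode (star c))
  map_add' := by simp
  map_smul' := by simp

variable (d : HopfAlgData H0)

lemma HopfAlgData.comul_star_sum {n : ℕ} {c : H0} {c₁ c₂ : Fin n → H0}
    (h : d.comul c = ∑ i, c₁ i ⊗ₜ c₂ i) :
    d.comul (star c) = ∑ i, star (c₁ i) ⊗ₜ star (c₂ i) := by
  rw [d.comul_star, h, tstarWith_sum_tmul]

lemma HopfAlgData.sum_antipodeInv_mul {n : ℕ} {c : H0} {c₁ c₂ : Fin n → H0}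
    (h : d.comul c = ∑ i, c₁ i ⊗ₜ c₂ i) :
    ∑ i, d.antipodeInv (c₂ i) * c₁ i = d.counit c • 1 := by
  have := congrArg star (d.antipode_right _ _ _ _ (d.comul_star_sum h))
  simpa [d.counit_star, HopfAlgData.antipodeInv] using this

lemma HopfAlgData.sum_mul_antipodeInv {n : ℕ} {c : H0} {c₁ c₂ : Fin n → H0}
    (h : d.comul c = ∑ i, c₁ i ⊗ₜ c₂ i) :
    ∑ i, c₂ i * d.antipodeInv (c₁ i) = d.counit c • 1 := by
  have := congrArg star (d.antipode_left _ _ _ _ (d.comul_star_sum h))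
  simpa [d.counit_star, HopfAlgData.antipodeInv] using this

/-- A bilinear map contracting every comultiplication to the counit does so in lifted form. -/
lemma HopfAlgData.lift_comul_eq {g : H0 →ₗ[ℂ] H0 →ₗ[ℂ] H0}
    (hg : ∀ (c : H0) (n : ℕ) (c₁ c₂ : Fin n → H0), d.comul c = ∑ i, c₁ i ⊗ₜ c₂ i →
      ∑ i, g (c₁ i) (c₂ i) = d.counit c • 1) (c : H0) :
    TensorProduct.lift g (d.comul c) = d.counit c • 1 := by
  obtain ⟨n, c₁, c₂, h⟩ := exists_fin_sum_tmul (d.comul c)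
  rw [← hg c n c₁ c₂ h, h]
  simp

/-- If `g (c₁, c₂) = ε(c)`, then `x₀ ⊗ g (x₁, x₂) = x ⊗ 1` in every comodule. -/
lemma HopfAlgData.sum_map_coaction {M : Type*} [AddCommGroup M] [Module ℂ M]
    {δ : M →ₗ[ℂ] M ⊗[ℂ] H0}
    (hδ : ∀ x, TensorProduct.map δ LinearMap.id (δ x)
      = (TensorProduct.assoc ℂ M H0 H0).symm
        (TensorProduct.map LinearMap.id d.comul.toLinearMap (δ x)))
    (hε : ∀ x, appRight d.counit.toLinearMap (δ x) = x)
    {g : H0 →ₗ[ℂ] H0 →ₗ[ℂ] H0}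
    (hg : ∀ (c : H0) (n : ℕ) (c₁ c₂ : Fin n → H0), d.comul c = ∑ i, c₁ i ⊗ₜ c₂ i →
      ∑ i, g (c₁ i) (c₂ i) = d.counit c • 1)
    {x : M} {n : ℕ} {x₀ : Fin n → M} {x₁ : Fin n → H0} (hx : δ x = ∑ i, x₀ i ⊗ₜ x₁ i) :
    ∑ i, (g.flip (x₁ i)).lTensor M (δ (x₀ i)) = x ⊗ₜ[ℂ] (1 : H0) := by
  have h := congrArg (fun t => (TensorProduct.lift g).lTensor M (TensorProduct.assoc ℂ M H0 H0 t))
    (hδ x)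
  simp only [LinearEquiv.apply_symm_apply] at h
  have hr : ∀ t : M ⊗[ℂ] H0, (TensorProduct.lift g).lTensor M
      (TensorProduct.map LinearMap.id d.comul.toLinearMap t)
      = appRight d.counit.toLinearMap t ⊗ₜ 1 := by
    intro t
    induction t with
    | zero => simp
    | add s t hs ht => simp only [map_add, hs, ht, TensorProduct.add_tmul]
    | tmul m c => simp [d.lift_comul_eq hg, TensorProduct.smul_tmul]
  have hl : ∀ (t : M ⊗[ℂ] H0) (c : H0), (TensorProduct.lift g).lTensor M
      (TensorProduct.assoc ℂ M H0 H0 (t ⊗ₜ c)) = (g.flip c).lTensor M t := by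
    intro t c
    induction t with
    | zero => simp
    | add s t hs ht => simp only [map_add, hs, ht, TensorProduct.add_tmul]
    | tmul m c => simp
  rw [hr, hε, hx] at h
  simpa [hl] using h

/-- The mirror image of `sum_map_coaction` for the comultiplication. -/
lemma HopfAlgData.sum_map_comul {g : H0 →ₗ[ℂ] H0 →ₗ[ℂ] H0}
    (hg : ∀ (c : H0) (n : ℕ) (c₁ c₂ : Fin n → H0), d.comul c = ∑ i, c₁ i ⊗ₜ c₂ i →
      ∑ i, g (c₁ i) (c₂ i) = d.counit c • 1)
    {c : H0} {n : ℕ} {c₁ c₂ : Fin n → H0} (hc : d.comul c = ∑ i, c₁ i ⊗ₜ c₂ i) :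
    ∑ i, (g (c₁ i)).rTensor H0 (d.comul (c₂ i)) = (1 : H0) ⊗ₜ[ℂ] c := by
  have h := congrArg (fun t => (TensorProduct.lift g).rTensor H0 t) (d.coassoc c)
  have hr : ∀ t : H0 ⊗[ℂ] H0, (TensorProduct.lift g).rTensor H0
      (TensorProduct.map d.comul.toLinearMap LinearMap.id t)
      = 1 ⊗ₜ TensorProduct.lid ℂ H0 (TensorProduct.map d.counit.toLinearMap LinearMap.id t) := by
    intro t
    induction t with
    | zero => simp
    | add s t hs ht => simp only [map_add, hs, ht, TensorProduct.tmul_add]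
    | tmul m c => simp [d.lift_comul_eq hg, TensorProduct.smul_tmul]
  have hl : ∀ (c : H0) (t : H0 ⊗[ℂ] H0), (TensorProduct.lift g).rTensor H0
      ((TensorProduct.assoc ℂ H0 H0 H0).symm (c ⊗ₜ t)) = (g c).rTensor H0 t := by
    intro c t
    induction t with
    | zero => simp
    | add s t hs ht => simp only [map_add, hs, ht, TensorProduct.tmul_add]
    | tmul m c => simp
  simp only [hr, d.counit_left] at h
  rw [h, hc]
  simp [hl]

end Hopf

section Haar
variable {H0 : Type u} [Ring H0] [Algebra ℂ H0]

lemma appRight_tmul_one_mul (h : H0 →ₗ[ℂ] ℂ) (a : H0) (z : H0 ⊗[ℂ] H0) :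
    appRight h ((a ⊗ₜ 1) * z) = a * appRight h z := by
  induction z with
  | zero => simp
  | add s t hs ht => simp only [mul_add, map_add, hs, ht]
  | tmul m c => simp

lemma appRight_mul_tmul_one (h : H0 →ₗ[ℂ] ℂ) (a : H0) (z : H0 ⊗[ℂ] H0) :
    appRight h (z * (a ⊗ₜ 1)) = appRight h z * a := by
  induction z with
  | zero => simp
  | add s t hs ht => simp only [add_mul, map_add, hs, ht]
  | tmul m c => simp

lemma appRight_one_tmul_mul (h : H0 →ₗ[ℂ] ℂ) (a : H0) (z : H0 ⊗[ℂ] H0) :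
    appRight h ((1 ⊗ₜ a) * z) = appRight (h ∘ₗ LinearMap.mulLeft ℂ a) z := by
  induction z with
  | zero => simp
  | add s t hs ht => simp only [mul_add, map_add, hs, ht]
  | tmul m c => simp

lemma appRight_mul_one_tmul (h : H0 →ₗ[ℂ] ℂ) (a : H0) (z : H0 ⊗[ℂ] H0) :
    appRight h (z * (1 ⊗ₜ a)) = appRight (h ∘ₗ LinearMap.mulRight ℂ a) z := by
  induction z with
  | zero => simp
  | add s t hs ht => simp only [add_mul, map_add, hs, ht]
  | tmul m c => simp

variable [StarRing H0] [StarModule ℂ H0] [FiniteDimensional ℂ H0] {d : HopfAlgData H0}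
  {h : H0 →ₗ[ℂ] ℂ} {t : H0} {n : ℕ} {t₁ t₂ : Fin n → H0}

lemma sum_smul_antipode_eq (hh : ∀ c, appRight h (d.comul c) = h c • 1)
    (ht : ∀ c, t * c = d.counit c • t) (hΔ : d.comul t = ∑ i, t₁ i ⊗ₜ t₂ i) (c : H0) :
    ∑ i, h (t₂ i * c) • d.antipode (t₁ i) = h t • c := by
  have key := d.sum_map_comul (g := (LinearMap.mul ℂ H0).comp d.antipode)
    (fun c n c₁ c₂ hc => by simpa using d.antipode_left c n c₁ c₂ hc) hΔ
  have hg : ∀ (a : H0) (z : H0 ⊗[ℂ] H0), (((LinearMap.mul ℂ H0).comp d.antipode) a).rTensor H0 z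
      = (d.antipode a ⊗ₜ 1) * z := by
    intro a z
    induction z with
    | zero => simp
    | add s t hs ht => simp only [map_add, mul_add, hs, ht]
    | tmul m c => simp
  simp only [hg] at key
  replace key := congrArg (fun z => appRight h (z * d.comul c)) key
  have hr : h ∘ₗ LinearMap.mulLeft ℂ t = h t • d.counit.toLinearMap := by
    ext x
    simp [ht, mul_comm]
  simp only [Finset.sum_mul, mul_assoc, ← map_mul, map_sum, appRight_tmul_one_mul, hh] at key
  simp only [appRight_one_tmul_mul, hr] at key
  rw [show appRight (h t • d.counit.toLinearMap) (d.comul c) = h t • c by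
    conv_rhs => rw [← d.counit_right c]
    simp [appRight, TensorProduct.map_smul_right]] at key
  simpa using key

lemma sum_smul_antipodeInv_eq (hh : ∀ c, appRight h (d.comul c) = h c • 1)
    (ht : ∀ c, c * t = d.counit c • t) (hΔ : d.comul t = ∑ i, t₁ i ⊗ₜ t₂ i) (c : H0) :
    ∑ i, h (c * t₂ i) • d.antipodeInv (t₁ i) = h t • c := by
  have key := d.sum_map_comul (g := (LinearMap.mul ℂ H0).flip.comp d.antipodeInv)
    (fun c n c₁ c₂ hc => by simpa using d.sum_mul_antipodeInv hc) hΔ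
  have hg : ∀ (a : H0) (z : H0 ⊗[ℂ] H0),
      (((LinearMap.mul ℂ H0).flip.comp d.antipodeInv) a).rTensor H0 z
      = z * (d.antipodeInv a ⊗ₜ 1) := by
    intro a z
    induction z with
    | zero => simp
    | add s t hs ht => simp only [map_add, add_mul, hs, ht]
    | tmul m c => simp
  simp only [hg] at key
  replace key := congrArg (fun z => appRight h (d.comul c * z)) key
  have hr : h ∘ₗ LinearMap.mulRight ℂ t = h t • d.counit.toLinearMap := by
    ext x
    simp [ht, mul_comm]
  simp only [Finset.mul_sum, ← mul_assoc, ← map_mul, map_sum, appRight_mul_tmul_one, hh] at key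
  simp only [appRight_mul_one_tmul, hr] at key
  rw [show appRight (h t • d.counit.toLinearMap) (d.comul c) = h t • c by
    conv_rhs => rw [← d.counit_right c]
    simp [appRight, TensorProduct.map_smul_right]] at key
  simpa using key

lemma sum_antipodeInv_smul_eq (hh : ∀ c, appRight h (d.comul c) = h c • 1)
    (ht : ∀ c, c * t = d.counit c • t) (hΔ : d.comul t = ∑ i, t₁ i ⊗ₜ t₂ i) (c : H0) :
    ∑ i, h (d.antipodeInv c * t₂ i) • t₁ i = h t • c := by
  obtain ⟨m, c₁, c₂, hc⟩ := exists_fin_sum_tmul (d.comul c)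
  have key := d.sum_map_coaction (δ := d.comul.toLinearMap) (fun c => d.coassoc c) d.counit_right
    (g := ((LinearMap.mul ℂ H0).comp d.antipodeInv).flip)
    (fun c n c₁ c₂ hc => by simpa using d.sum_antipodeInv_mul hc) hc
  have hg : ∀ (a : H0) (z : H0 ⊗[ℂ] H0),
      ((((LinearMap.mul ℂ H0).comp d.antipodeInv).flip).flip a).lTensor H0 z
      = (1 ⊗ₜ d.antipodeInv a) * z := by
    intro a z
    induction z with
    | zero => simp
    | add s t hs ht => simp only [map_add, mul_add, hs, ht]
    | tmul m c => simp
  simp only [hg] at key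
  replace key := congrArg (fun z => appRight h (z * d.comul t)) key
  have hcε : ∑ i, d.counit (c₁ i) • c₂ i = c := by
    conv_rhs => rw [← d.counit_left c, hc]
    simp
  simp only [AlgHom.toLinearMap_apply, Finset.sum_mul, mul_assoc, ← map_mul, ht] at key
  have hl : ∑ i, (1 : H0) ⊗ₜ[ℂ] d.antipodeInv (c₂ i) * d.comul (d.counit (c₁ i) • t)
      = 1 ⊗ₜ[ℂ] d.antipodeInv c * d.comul t := by
    conv_rhs => rw [← hcε]
    simp [TensorProduct.tmul_sum, Finset.sum_mul]
  rw [hl, appRight_tmul_one_mul, hh, hΔ] at key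
  simpa [Finset.mul_sum] using key

lemma haar_apply_ne_zero (hS : Function.Injective d.antipode)
    (hh : ∀ c, appRight h (d.comul c) = h c • 1) (h1 : h 1 = 1)
    (ht : ∀ c, t * c = d.counit c • t) (htε : d.counit t = 1) : h t ≠ 0 := by
  intro h0
  obtain ⟨n, t₁, t₂, hΔ⟩ := exists_fin_sum_tmul (d.comul t)
  have hz : ∀ c, ∑ i, h (t₂ i * c) • t₁ i = 0 := fun c => hS <| by
    simpa [h0] using sum_smul_antipode_eq hh ht hΔ c
  have hG : ∑ i, (h ∘ₗ LinearMap.mulLeft ℂ (t₂ i)).smulRight (d.antipodeInv (t₁ i)) = 0 := by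
    ext c
    simpa using congrArg d.antipodeInv (hz c)
  have htr := congrArg (LinearMap.trace ℂ H0) hG
  simp only [map_sum, LinearMap.trace_smulRight, LinearMap.comp_apply, LinearMap.mulLeft_apply,
    map_zero] at htr
  rw [← map_sum, d.sum_mul_antipodeInv hΔ, htε] at htr
  simp [h1] at htr

/-- The modular property of the Haar functional. -/
lemma haar_antipodeInv_mul (hS : Function.Injective d.antipode)
    (hh : ∀ c, appRight h (d.comul c) = h c • 1) (h1 : h 1 = 1)
    (ht : ∀ c, c * t = d.counit c • t) (ht' : ∀ c, t * c = d.counit c • t)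
    (htε : d.counit t = 1) (c x : H0) :
    h (d.antipodeInv c * x) = h (x * d.antipode c) := by
  have hne := haar_apply_ne_zero hS hh h1 ht' htε
  obtain ⟨n, t₁, t₂, hΔ⟩ := exists_fin_sum_tmul (d.comul t)
  have hnd : ∀ k, (∀ y, h (k * y) = 0) → k = 0 := by
    intro k hk
    have := sum_smul_antipodeInv_eq hh ht hΔ k
    simp only [hk, zero_smul, Finset.sum_const_zero] at this
    exact (smul_eq_zero.mp this.symm).resolve_left hne
  have hx : ∑ i, h (x * d.antipode (t₁ i)) • t₂ i = h t • x := by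
    rw [← sub_eq_zero]
    refine hnd _ fun y => ?_
    have := congrArg (fun z => h (x * z)) (sum_smul_antipode_eq hh ht' hΔ y)
    simp only [Finset.mul_sum, map_sum, mul_smul_comm, map_smul, smul_eq_mul] at this
    simp [sub_mul, Finset.sum_mul, ← this, mul_comm]
  have h2 := congrArg (fun z => h (d.antipodeInv c * z)) hx
  have h3 := congrArg (fun z => h (x * d.antipode z)) (sum_antipodeInv_smul_eq hh ht hΔ c)
  simp only [Finset.mul_sum, map_sum, mul_smul_comm, map_smul, smul_eq_mul] at h2 h3
  refine mul_left_cancel₀ hne ?_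
  rw [← h2, ← h3]
  exact Finset.sum_congr rfl fun i _ => mul_comm _ _

end Haar

section HopfPair
variable {H H0 : Type u} [Ring H] [Algebra ℂ H] [StarRing H] [StarModule ℂ H]
  [FiniteDimensional ℂ H] [Ring H0] [Algebra ℂ H0] [StarRing H0] [StarModule ℂ H0]
  [FiniteDimensional ℂ H0] (dp : HopfPairData H H0)

lemma HopfPairData.eq_of_pair_eq {x y : H0} (hxy : ∀ l, dp.pair l x = dp.pair l y) : x = y :=
  dp.perfect'.1 (LinearMap.ext hxy)

lemma HopfPairData.antipode_injective : Function.Injective dp.dH0.antipode := by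
  intro x y hxy
  have key : ∀ (l : H) (z : H0),
      dp.pair l z = dp.pair l (star (dp.dH0.antipode (star (dp.dH0.antipode z)))) := by
    intro l z
    conv_lhs => rw [← star_star l, dp.pair_star, dp.pair_star]
    simp
  exact dp.eq_of_pair_eq fun l => by rw [key, hxy, ← key]

lemma HopfPairData.appRight_haar_comul (c : H0) :
    appRight (dp.pair dp.haar) (dp.dH0.comul c) = dp.pair dp.haar c • 1 := by
  refine dp.eq_of_pair_eq fun l => ?_
  obtain ⟨n, c₁, c₂, hc⟩ := exists_fin_sum_tmul (dp.dH0.comul c)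
  have h := dp.pair_mul_left l dp.haar c n c₁ c₂ hc
  rw [dp.haar_absorb] at h
  rw [hc]
  simpa [dp.pair_one_right, mul_comm] using h.symm

lemma HopfPairData.haar_antipodeInv_mul (c x : H0) :
    dp.pair dp.haar (dp.dH0.antipodeInv c * x) = dp.pair dp.haar (x * dp.dH0.antipode c) :=
  SMEPaper.haar_antipodeInv_mul dp.antipode_injective dp.appRight_haar_comul
    (by rw [dp.pair_one_right, dp.counit_haar]) dp.haar0_absorb dp.haar0_absorb' dp.counit_haar0 c x

end HopfPair

/-! ### Covariance of the Haar expectation -/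

section Covariance

section Slice
variable {P Q R C : Type*} [AddCommGroup P] [Module ℂ P] [AddCommGroup Q] [Module ℂ Q]
  [AddCommGroup R] [Module ℂ R] [Ring C] [Algebra ℂ C]

lemma map₂_mul_lTensor_mulRight (op : P →ₗ[ℂ] Q →ₗ[ℂ] R) (c : C) (s : P ⊗[ℂ] C)
    (t : Q ⊗[ℂ] C) :
    TensorProduct.map₂ op (LinearMap.mul ℂ C) s ((LinearMap.mulRight ℂ c).lTensor Q t)
      = (LinearMap.mulRight ℂ c).lTensor R (TensorProduct.map₂ op (LinearMap.mul ℂ C) s t) := by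
  induction s with
  | zero => simp
  | add s s' hs hs' => simp only [map_add, LinearMap.add_apply, hs, hs']
  | tmul p a =>
    induction t with
    | zero => simp
    | add t t' ht ht' => simp only [map_add, ht, ht']
    | tmul q b => simp [mul_assoc]

lemma map₂_mul_lTensor_mulLeft (op : P →ₗ[ℂ] Q →ₗ[ℂ] R) (c : C) (s : P ⊗[ℂ] C)
    (t : Q ⊗[ℂ] C) :
    TensorProduct.map₂ op (LinearMap.mul ℂ C) ((LinearMap.mulLeft ℂ c).lTensor P s) t
      = (LinearMap.mulLeft ℂ c).lTensor R (TensorProduct.map₂ op (LinearMap.mul ℂ C) s t) := by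
  induction s with
  | zero => simp
  | add s s' hs hs' => simp only [map_add, LinearMap.add_apply, hs, hs']
  | tmul p a =>
    induction t with
    | zero => simp
    | add t t' ht ht' => simp only [map_add, ht, ht']
    | tmul q b => simp [mul_assoc]

lemma appRight_map₂_mul_tmul_one (op : P →ₗ[ℂ] Q →ₗ[ℂ] R) (f : C →ₗ[ℂ] ℂ) (s : P ⊗[ℂ] C)
    (q : Q) :
    appRight f (TensorProduct.map₂ op (LinearMap.mul ℂ C) s (q ⊗ₜ 1)) = op (appRight f s) q := by
  induction s with
  | zero => simp
  | add s s' hs hs' => simp only [map_add, LinearMap.add_apply, hs, hs']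
  | tmul p a => simp

lemma appRight_map₂_mul_one_tmul (op : P →ₗ[ℂ] Q →ₗ[ℂ] R) (f : C →ₗ[ℂ] ℂ) (p : P)
    (t : Q ⊗[ℂ] C) :
    appRight f (TensorProduct.map₂ op (LinearMap.mul ℂ C) (p ⊗ₜ 1) t) = op p (appRight f t) := by
  induction t with
  | zero => simp
  | add t t' ht ht' => simp only [map_add, ht, ht']
  | tmul q b => simp

lemma appRight_lTensor (f : C →ₗ[ℂ] ℂ) (g : C →ₗ[ℂ] C) (s : P ⊗[ℂ] C) :
    appRight f (g.lTensor P s) = appRight (f ∘ₗ g) s := by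
  induction s with
  | zero => simp
  | add s s' hs hs' => simp only [map_add, hs, hs']
  | tmul p a => simp

end Slice

variable {A B X : Type u} [Ring A] [Algebra ℂ A] [StarRing A]
  [Ring B] [Algebra ℂ B] [StarRing B] [AddCommGroup X] [Module ℂ X]

/-- The left action of a Hilbert bimodule as a bilinear map. -/
def Bimod.lsₗ (bm : Bimod A B X) : A →ₗ[ℂ] X →ₗ[ℂ] X :=
  LinearMap.mk₂ ℂ bm.ls bm.ls_add bm.ls_smul bm.ls_add' bm.ls_smul'

/-- The right action of a Hilbert bimodule as a bilinear map. -/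
def Bimod.rsₗ (bm : Bimod A B X) : X →ₗ[ℂ] B →ₗ[ℂ] X :=
  LinearMap.mk₂ ℂ bm.rs bm.rs_add' bm.rs_smul' bm.rs_add bm.rs_smul

/-- The left inner product of a Hilbert bimodule as a sesquilinear map. -/
def Bimod.linnₗ (bm : Bimod A B X) : X →ₗ[ℂ] X →ₛₗ[starRingEnd ℂ] A :=
  LinearMap.mk₂'ₛₗ _ _ bm.linn bm.linn_add_left bm.linn_smul_left bm.linn_add_right
    bm.linn_smul_right

@[simp] lemma Bimod.lsₗ_apply (bm : Bimod A B X) (a : A) (x : X) : bm.lsₗ a x = bm.ls a x := rfl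

@[simp] lemma Bimod.rsₗ_apply (bm : Bimod A B X) (x : X) (b : B) : bm.rsₗ x b = bm.rs x b := rfl

@[simp] lemma Bimod.linnₗ_apply (bm : Bimod A B X) (x y : X) :
    bm.linnₗ x y = bm.linn x y := rfl

variable {H H0 : Type u} [Ring H] [Algebra ℂ H] [StarRing H] [StarModule ℂ H]
  [FiniteDimensional ℂ H] [Ring H0] [Algebra ℂ H0] [StarRing H0] [StarModule ℂ H0]
  [FiniteDimensional ℂ H0]

/-- The defect of `p x = x q` after applying the Haar projection to `p` and `q` is computed
from the defects of `p x₀ = x₀ q`, where `λ(x) = x₀ ⊗ x₁`. -/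
lemma coactAct_haar_sub {dp : HopfPairData H H0} {bm : Bimod A B X} {ρ : A →ₗ[ℂ] A ⊗[ℂ] H0}
    {σ : B →ₗ[ℂ] B ⊗[ℂ] H0} {lam : X →ₗ[ℂ] X ⊗[ℂ] H0}
    (hlam : IsCoactionBimod dp.dH0.comul.toLinearMap dp.dH0.counit.toLinearMap bm ρ σ lam)
    (p : A) (q : B) {x : X} {n : ℕ} {x₀ : Fin n → X} {x₁ : Fin n → H0}
    (hx : lam x = ∑ i, x₀ i ⊗ₜ x₁ i) :
    bm.ls (coactAct dp ρ dp.haar p) x - bm.rs x (coactAct dp σ dp.haar q)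
      = ∑ i, appRight (dp.pair dp.haar ∘ₗ LinearMap.mulRight ℂ (dp.dH0.antipode (x₁ i)))
          (lam (bm.ls p (x₀ i) - bm.rs (x₀ i) q)) := by
  have hl : ∀ a y, lam (bm.ls a y)
      = TensorProduct.map₂ bm.lsₗ (LinearMap.mul ℂ H0) (ρ a) (lam y) := fun a y => by
    rw [hlam.ls_compat, ← tact_eq_map₂]
    rfl
  have hr : ∀ y b, lam (bm.rs y b)
      = TensorProduct.map₂ bm.rsₗ (LinearMap.mul ℂ H0) (lam y) (σ b) := fun y b => by
    rw [hlam.rs_compat, ← tact_eq_map₂]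
    rfl
  have h₁ := dp.dH0.sum_map_coaction hlam.coassoc hlam.counital
    (g := (LinearMap.mul ℂ H0).compl₂ dp.dH0.antipode)
    (fun c n c₁ c₂ hc => by simpa using dp.dH0.antipode_right c n c₁ c₂ hc) hx
  have h₂ := dp.dH0.sum_map_coaction hlam.coassoc hlam.counital
    (g := ((LinearMap.mul ℂ H0).comp dp.dH0.antipodeInv).flip)
    (fun c n c₁ c₂ hc => by simpa using dp.dH0.sum_antipodeInv_mul hc) hx
  have hf₁ : ∀ c, ((LinearMap.mul ℂ H0).compl₂ dp.dH0.antipode).flip c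
      = LinearMap.mulRight ℂ (dp.dH0.antipode c) := fun c => by ext; simp
  have hf₂ : ∀ c, ((LinearMap.mul ℂ H0).comp dp.dH0.antipodeInv).flip.flip c
      = LinearMap.mulLeft ℂ (dp.dH0.antipodeInv c) := fun c => by ext; simp
  have hf : ∀ c, dp.pair dp.haar ∘ₗ LinearMap.mulLeft ℂ (dp.dH0.antipodeInv c)
      = dp.pair dp.haar ∘ₗ LinearMap.mulRight ℂ (dp.dH0.antipode c) := fun c => by
    ext y
    simpa using dp.haar_antipodeInv_mul c y
  simp only [hf₁] at h₁
  simp only [hf₂] at h₂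
  have hleft : bm.ls (coactAct dp ρ dp.haar p) x
      = ∑ i, appRight (dp.pair dp.haar ∘ₗ LinearMap.mulRight ℂ (dp.dH0.antipode (x₁ i)))
          (lam (bm.ls p (x₀ i))) := by
    rw [coactAct, ← bm.lsₗ_apply, ← appRight_map₂_mul_tmul_one, ← h₁]
    simp [map₂_mul_lTensor_mulRight, appRight_lTensor, hl]
  have hright : bm.rs x (coactAct dp σ dp.haar q)
      = ∑ i, appRight (dp.pair dp.haar ∘ₗ LinearMap.mulRight ℂ (dp.dH0.antipode (x₁ i)))
          (lam (bm.rs (x₀ i) q)) := by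
    rw [coactAct, ← bm.rsₗ_apply, ← appRight_map₂_mul_one_tmul, ← h₂]
    simp [LinearMap.sum_apply, map₂_mul_lTensor_mulLeft, appRight_lTensor, hr, hf]
  simp only [hleft, hright, map_sub, Finset.sum_sub_distrib]

end Covariance

/-! ### Norm estimates in Hilbert bimodules -/

section CStar
variable {A : Type*} [CStarAlgebra A]

lemma norm_sum_star_mul_self_le_norm_add {ι κ : Type*} [Fintype ι] [Fintype κ] (a : ι → A)
    (b : κ → A) :
    ‖∑ i, star (a i) * a i‖ ≤ ‖∑ i, star (a i) * a i + ∑ j, star (b j) * b j‖ := by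
  let _ := CStarAlgebra.spectralOrder A
  have := CStarAlgebra.spectralOrderedRing A
  exact CStarAlgebra.norm_le_norm_of_nonneg_of_le
    (Finset.sum_nonneg fun i _ => star_mul_self_nonneg (a i))
    (le_add_of_nonneg_right (Finset.sum_nonneg fun j _ => star_mul_self_nonneg (b j)))

lemma norm_star_mul_self_le_norm_add (a b : A) :
    ‖star a * a‖ ≤ ‖star a * a + star b * b‖ := by
  simpa using norm_sum_star_mul_self_le_norm_add (fun _ : Unit => a) (fun _ : Unit => b)

lemma exists_star_mul_self_add_eq (a : A) :
    ∃ s : A, star a * a + star s * s = ((‖a‖ ^ 2 : ℝ) : ℂ) • 1 := by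
  let _ := CStarAlgebra.spectralOrder A
  have := CStarAlgebra.spectralOrderedRing A
  have h : star a * a ≤ algebraMap ℝ A (‖a‖ ^ 2) := CStarAlgebra.star_mul_le_algebraMap_norm_sq
  obtain ⟨s, hs⟩ := CStarAlgebra.nonneg_iff_eq_star_mul_self.mp (sub_nonneg.mpr h)
  refine ⟨s, ?_⟩
  rw [← hs, add_sub_cancel, Algebra.algebraMap_eq_smul_one, Complex.coe_smul]

lemma exists_isSelfAdjoint_mul_self_eq (a : A) :
    ∃ s : A, IsSelfAdjoint s ∧ star a * a = s * s := by
  let _ := CStarAlgebra.spectralOrder A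
  have := CStarAlgebra.spectralOrderedRing A
  exact CStarAlgebra.nonneg_iff_exists_isSelfAdjoint_and_eq_mul_self.mp (star_mul_self_nonneg a)

end CStar

namespace Bimod
variable {A B X : Type u} [CStarAlgebra A] [CStarAlgebra B] [AddCommGroup X] [Module ℂ X]
  {bm : Bimod A B X}

lemma ls_sub (bm : Bimod A B X) (a a' : A) (x : X) :
    bm.ls (a - a') x = bm.ls a x - bm.ls a' x := by
  simp [← lsₗ_apply]

lemma ls_sub' (bm : Bimod A B X) (a : A) (x y : X) :
    bm.ls a (x - y) = bm.ls a x - bm.ls a y := by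
  simp [← lsₗ_apply]

lemma rs_sub (bm : Bimod A B X) (x : X) (b b' : B) :
    bm.rs x (b - b') = bm.rs x b - bm.rs x b' := by
  simp [← rsₗ_apply]

lemma rs_sub' (bm : Bimod A B X) (x y : X) (b : B) :
    bm.rs (x - y) b = bm.rs x b - bm.rs y b := by
  simp [← rsₗ_apply]

lemma linn_ls_right (bm : Bimod A B X) (x y : X) (a : A) :
    bm.linn x (bm.ls a y) = bm.linn x y * star a := by
  rw [← bm.linn_star, bm.linn_ls, star_mul, bm.linn_star]

lemma linn_rs_mul_star (bm : Bimod A B X) (x : X) (b : B) :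
    bm.linn (bm.rs x (b * star b)) x = bm.linn (bm.rs x b) (bm.rs x b) := by
  rw [bm.rs_mul, bm.linn_rs, star_star]

lemma eq_zero_of_linn_self (h : bm.IsEquivalence) {x : X} (hx : bm.linn x x = 0) : x = 0 := by
  have h₀ : bm.rs x (bm.rinn x x) = 0 := by
    rw [← h.1, hx]
    simp [← lsₗ_apply]
  have h₁ : star (bm.rinn x x) * bm.rinn x x = 0 := by
    rw [bm.rinn_star, ← bm.rinn_rs, h₀]
    simpa using bm.rinn_smul_right 0 x 0
  exact bm.rinn_def x ((CStarRing.star_mul_self_eq_zero_iff _).mp h₁)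

/-- The opposite of an equivalence bimodule, over the opposite algebras. -/
def op (bm : Bimod A B X) (h : bm.IsEquivalence) : Bimod Bᵐᵒᵖ Aᵐᵒᵖ X where
  ls b x := bm.rs x b.unop
  rs x a := bm.ls a.unop x
  linn x y := .op (bm.rinn y x)
  rinn x y := .op (bm.linn y x)
  ls_one := bm.rs_one
  ls_mul _ _ _ := bm.rs_mul _ _ _
  ls_add _ _ _ := bm.rs_add _ _ _
  ls_add' _ _ _ := bm.rs_add' _ _ _
  ls_smul _ _ _ := bm.rs_smul _ _ _
  ls_smul' _ _ _ := bm.rs_smul' _ _ _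
  rs_one := bm.ls_one
  rs_mul _ _ _ := bm.ls_mul _ _ _
  rs_add _ _ _ := bm.ls_add _ _ _
  rs_add' _ _ _ := bm.ls_add' _ _ _
  rs_smul _ _ _ := bm.ls_smul _ _ _
  rs_smul' _ _ _ := bm.ls_smul' _ _ _
  ls_rs _ _ _ := (bm.ls_rs _ _ _).symm
  linn_add_left _ _ _ := congrArg _ (bm.rinn_add_right _ _ _)
  linn_add_right _ _ _ := congrArg _ (bm.rinn_add_left _ _ _)
  rinn_add_left _ _ _ := congrArg _ (bm.linn_add_right _ _ _)
  rinn_add_right _ _ _ := congrArg _ (bm.linn_add_left _ _ _)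
  linn_smul_left _ _ _ := congrArg _ (bm.rinn_smul_right _ _ _)
  linn_smul_right _ _ _ := congrArg _ (bm.rinn_smul_left _ _ _)
  rinn_smul_left _ _ _ := congrArg _ (bm.linn_smul_right _ _ _)
  rinn_smul_right _ _ _ := congrArg _ (bm.linn_smul_left _ _ _)
  linn_star _ _ := congrArg _ (bm.rinn_star _ _)
  rinn_star _ _ := congrArg _ (bm.linn_star _ _)
  linn_ls _ _ _ := congrArg _ (bm.rinn_rs _ _ _)
  rinn_rs _ _ _ := congrArg _ (bm.linn_ls _ _ _)
  linn_rs x y a := congrArg _ (by simpa using (bm.rinn_ls (star a.unop) y x).symm)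
  rinn_ls b x y := congrArg _ (by simpa using (bm.linn_rs y x (star b.unop)).symm)
  linn_pos x := by
    obtain ⟨b, hb⟩ := bm.rinn_pos x
    obtain ⟨s, hs, hbs⟩ := exists_isSelfAdjoint_mul_self_eq b
    exact ⟨.op s, by rw [hb, hbs, ← MulOpposite.op_star, hs.star_eq, MulOpposite.op_mul]⟩
  rinn_pos x := by
    obtain ⟨a, ha⟩ := bm.linn_pos x
    obtain ⟨s, hs, has⟩ := exists_isSelfAdjoint_mul_self_eq a
    exact ⟨.op s, by rw [ha, has, ← MulOpposite.op_star, hs.star_eq, MulOpposite.op_mul]⟩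
  rinn_def _ hx := eq_zero_of_linn_self h (MulOpposite.op_injective hx)

lemma span_range_op {S : Type*} [AddCommGroup S] [Module ℂ S] {f : X → X → S}
    (hf : Submodule.span ℂ (Set.range fun p : X × X => f p.1 p.2) = ⊤) :
    Submodule.span ℂ (Set.range fun p : X × X => MulOpposite.op (f p.2 p.1)) = ⊤ := by
  have hr : (Set.range fun p : X × X => MulOpposite.op (f p.2 p.1))
      = (MulOpposite.opLinearEquiv ℂ : S ≃ₗ[ℂ] Sᵐᵒᵖ) '' Set.range fun p : X × X => f p.1 p.2 := by
    rw [← Set.range_comp]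
    exact (Prod.swap_surjective.range_comp
      (MulOpposite.op ∘ fun p : X × X => f p.1 p.2))
  rw [hr, ← LinearEquiv.coe_coe, Submodule.span_image, hf, Submodule.map_top, LinearEquiv.range]

lemma IsEquivalence.op (h : bm.IsEquivalence) : (bm.op h).IsEquivalence :=
  ⟨fun x y z => (h.1 z y x).symm, span_range_op h.2.2, span_range_op h.2.1⟩

lemma norm_linn_rs_self_le (bm : Bimod A B X) (x : X) (b : B) :
    ‖bm.linn (bm.rs x b) (bm.rs x b)‖ ≤ ‖b‖ ^ 2 * ‖bm.linn x x‖ := by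
  obtain ⟨s, hs⟩ := exists_star_mul_self_add_eq (star b)
  obtain ⟨c, hc⟩ := bm.linn_pos (bm.rs x b)
  obtain ⟨d, hd⟩ := bm.linn_pos (bm.rs x (star s))
  have h := norm_star_mul_self_le_norm_add c d
  rw [← hc, ← hd, ← bm.linn_rs_mul_star, ← bm.linn_rs_mul_star, ← bm.linn_add_left, ← bm.rs_add,
    star_star, ← star_star b, star_star (star b), hs, bm.rs_smul, bm.rs_one, bm.linn_smul_left,
    norm_smul] at h
  simpa [bm.linn_rs_mul_star] using h

lemma norm_linn_ls_self_le (bm : Bimod A B X) (a : A) (x : X) :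
    ‖bm.linn (bm.ls a x) (bm.ls a x)‖ ≤ ‖a‖ ^ 2 * ‖bm.linn x x‖ := by
  rw [bm.linn_ls, bm.linn_ls_right]
  calc ‖a * (bm.linn x x * star a)‖ ≤ ‖a‖ * (‖bm.linn x x‖ * ‖star a‖) :=
        (norm_mul_le _ _).trans (by gcongr; exact norm_mul_le _ _)
    _ = ‖a‖ ^ 2 * ‖bm.linn x x‖ := by rw [norm_star]; ring

lemma norm_linn_rs_rinn_self_le (bm : Bimod A B X) (x y : X) :
    ‖bm.linn (bm.rs x (bm.rinn y y)) x‖ ≤ ‖bm.rinn y y‖ * ‖bm.linn x x‖ := by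
  obtain ⟨d, hd⟩ := bm.rinn_pos y
  have h := bm.norm_linn_rs_self_le x (star d)
  rwa [← bm.linn_rs_mul_star, star_star, ← hd, norm_star, sq, ← CStarRing.norm_star_mul_self,
    ← hd] at h

lemma norm_linn_self_le_norm_rinn_self (h : bm.IsEquivalence) (x : X) :
    ‖bm.linn x x‖ ≤ ‖bm.rinn x x‖ := by
  have h₁ := bm.norm_linn_rs_rinn_self_le x x
  rw [← h.1, bm.linn_ls] at h₁
  nth_rw 1 [← bm.linn_star] at h₁
  rw [CStarRing.norm_star_mul_self] at h₁
  rcases (norm_nonneg (bm.linn x x)).eq_or_lt with h₀ | h₀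
  · exact h₀ ▸ norm_nonneg _
  · exact le_of_mul_le_mul_right h₁ h₀

lemma norm_rinn_self (h : bm.IsEquivalence) (x : X) : ‖bm.rinn x x‖ = ‖bm.linn x x‖ :=
  (norm_linn_self_le_norm_rinn_self h.op x).antisymm (norm_linn_self_le_norm_rinn_self h x)

lemma norm_linn_sq_le (h : bm.IsEquivalence) (x y : X) :
    ‖bm.linn x y‖ ^ 2 ≤ ‖bm.linn x x‖ * ‖bm.linn y y‖ := by
  have h₁ := bm.norm_linn_rs_rinn_self_le x y
  rw [← h.1, bm.linn_ls, norm_rinn_self h, ← bm.linn_star x y, CStarRing.norm_self_mul_star] at h₁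
  linarith

lemma norm_rinn_sq_le (h : bm.IsEquivalence) (x y : X) :
    ‖bm.rinn x y‖ ^ 2 ≤ ‖bm.linn x x‖ * ‖bm.linn y y‖ := by
  have h₁ : ‖bm.rinn x y‖ ^ 2 ≤ ‖bm.rinn y y‖ * ‖bm.rinn x x‖ := norm_linn_sq_le h.op y x
  rwa [norm_rinn_self h, norm_rinn_self h, mul_comm] at h₁

lemma norm_linn_add_self_le (bm : Bimod A B X) (x y : X) :
    ‖bm.linn (x + y) (x + y)‖ ≤ 2 * (‖bm.linn x x‖ + ‖bm.linn y y‖) := by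
  obtain ⟨c, hc⟩ := bm.linn_pos (x + y)
  obtain ⟨d, hd⟩ := bm.linn_pos (x - y)
  have h := norm_star_mul_self_le_norm_add c d
  have hp : bm.linn (x + y) (x + y) + bm.linn (x - y) (x - y)
      = (2 : ℂ) • (bm.linn x x + bm.linn y y) := by
    simp only [← linnₗ_apply, map_add, map_sub, LinearMap.add_apply, LinearMap.sub_apply, two_smul]
    abel
  rw [← hc, ← hd, hp, norm_smul] at h
  refine h.trans ?_
  rw [RCLike.norm_ofNat]
  gcongr
  exact norm_add_le _ _

/-! ### Null sequences and approximate intertwining -/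

/-- The sequence `w` tends to zero in the norm of the bimodule. -/
def IsNull (bm : Bimod A B X) (w : ℕ → X) : Prop :=
  Tendsto (fun n => ‖bm.linn (w n) (w n)‖) atTop (𝓝 0)

lemma isNull_op_iff (h : bm.IsEquivalence) {w : ℕ → X} : (bm.op h).IsNull w ↔ bm.IsNull w := by
  have : ∀ n, ‖(bm.op h).linn (w n) (w n)‖ = ‖bm.linn (w n) (w n)‖ :=
    fun n => norm_rinn_self h (w n)
  simp only [IsNull, this]

lemma isNull_zero (bm : Bimod A B X) : bm.IsNull fun _ => 0 := by
  simp [IsNull, ← linnₗ_apply]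

lemma IsNull.add {v w : ℕ → X} (hv : bm.IsNull v) (hw : bm.IsNull w) :
    bm.IsNull fun n => v n + w n :=
  squeeze_zero (fun _ => norm_nonneg _) (fun _ => bm.norm_linn_add_self_le _ _)
    (by simpa using (Tendsto.add hv hw).const_mul 2)

lemma IsNull.sum {ι : Type*} (s : Finset ι) {w : ι → ℕ → X} (hw : ∀ i ∈ s, bm.IsNull (w i)) :
    bm.IsNull fun n => ∑ i ∈ s, w i n := by
  classical
  induction s using Finset.induction_on with
  | empty => simpa using bm.isNull_zero
  | insert i s hi ih =>
    simp only [Finset.sum_insert hi]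
    exact (hw i (by simp)).add (ih fun j hj => hw j (by simp [hj]))

lemma IsNull.ls {w : ℕ → X} (hw : bm.IsNull w) {a : ℕ → A} {M : ℝ} (ha : ∀ n, ‖a n‖ ≤ M) :
    bm.IsNull fun n => bm.ls (a n) (w n) :=
  squeeze_zero (fun _ => norm_nonneg _)
    (fun n => (bm.norm_linn_ls_self_le _ _).trans (mul_le_mul_of_nonneg_right
      (pow_le_pow_left₀ (norm_nonneg _) (ha n) 2) (norm_nonneg _)))
    (by simpa using Tendsto.const_mul (M ^ 2) hw)

lemma IsNull.rs {w : ℕ → X} (hw : bm.IsNull w) {b : ℕ → B} {M : ℝ} (hb : ∀ n, ‖b n‖ ≤ M) :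
    bm.IsNull fun n => bm.rs (w n) (b n) :=
  squeeze_zero (fun _ => norm_nonneg _)
    (fun n => (bm.norm_linn_rs_self_le _ _).trans (mul_le_mul_of_nonneg_right
      (pow_le_pow_left₀ (norm_nonneg _) (hb n) 2) (norm_nonneg _)))
    (by simpa using Tendsto.const_mul (M ^ 2) hw)

lemma IsNull.smul {w : ℕ → X} (hw : bm.IsNull w) (c : ℂ) : bm.IsNull fun n => c • w n := by
  have : ∀ n, c • w n = bm.ls (c • 1) (w n) := fun n => by rw [bm.ls_smul, bm.ls_one]
  simpa only [this] using hw.ls fun _ => le_refl ‖(c • 1 : A)‖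

lemma IsNull.sub {v w : ℕ → X} (hv : bm.IsNull v) (hw : bm.IsNull w) :
    bm.IsNull fun n => v n - w n := by
  simpa [sub_eq_add_neg] using hv.add (hw.smul (-1))

lemma isNull_ls {a : ℕ → A} (ha : Tendsto (fun n => ‖a n‖) atTop (𝓝 0)) (x : X) :
    bm.IsNull fun n => bm.ls (a n) x :=
  squeeze_zero (fun _ => norm_nonneg _) (fun n => bm.norm_linn_ls_self_le _ _)
    (by simpa using (ha.pow 2).mul_const ‖bm.linn x x‖)

lemma IsNull.tendsto_rinn (h : bm.IsEquivalence) {w : ℕ → X} (hw : bm.IsNull w) (x : X) :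
    Tendsto (fun n => bm.rinn x (w n)) atTop (𝓝 0) := by
  rw [tendsto_zero_iff_norm_tendsto_zero]
  refine squeeze_zero (fun _ => norm_nonneg _)
    (fun n => Real.le_sqrt_of_sq_le (norm_rinn_sq_le h x (w n))) ?_
  simpa using (Tendsto.const_mul ‖bm.linn x x‖ hw).sqrt

lemma exists_sum_rinn_eq_one (h : bm.IsEquivalence) :
    ∃ (n : ℕ) (x y : Fin n → X), ∑ i, bm.rinn (x i) (y i) = 1 := by
  have h₁ : (1 : B) ∈ Submodule.span ℂ (Set.range fun p : X × X => bm.rinn p.1 p.2) := by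
    rw [h.2.2]
    trivial
  obtain ⟨n, c, g, hg⟩ := Submodule.mem_span_set'.mp h₁
  choose z hz using fun i => (g i).2
  refine ⟨n, fun i => (z i).1, fun i => c i • (z i).2, ?_⟩
  rw [← hg]
  exact Finset.sum_congr rfl fun i _ => by rw [bm.rinn_smul_right, ← hz i]

/-- A sequence in `B` acting as a null sequence on every vector tends to zero. -/
lemma tendsto_norm_of_isNull_rs (h : bm.IsEquivalence) {b : ℕ → B}
    (hb : ∀ x, bm.IsNull fun n => bm.rs x (b n)) :
    Tendsto (fun n => ‖b n‖) atTop (𝓝 0) := by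
  obtain ⟨k, x, y, hxy⟩ := exists_sum_rinn_eq_one h
  have hb' : ∀ n, b n = ∑ i, bm.rinn (x i) (bm.rs (y i) (b n)) := fun n => by
    simp only [bm.rinn_rs]
    rw [← Finset.sum_mul, hxy, one_mul]
  rw [← tendsto_zero_iff_norm_tendsto_zero, funext hb']
  simpa using tendsto_finsetSum Finset.univ fun i _ => (hb (y i)).tendsto_rinn h (x i)

end Bimod

/-! ### Transfer of approximately central projections -/

/-- The sequence `p` represents a projection in the central sequence algebra. -/
structure IsCentralProjectionSeq {A : Type*} [CStarAlgebra A] (p : ℕ → A) : Prop where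
  bounded : ∃ M, ∀ n, ‖p n‖ ≤ M
  star_sub : Tendsto (fun n => ‖star (p n) - p n‖) atTop (𝓝 0)
  idem : Tendsto (fun n => ‖p n * p n - p n‖) atTop (𝓝 0)
  central : ∀ a : A, Tendsto (fun n => ‖p n * a - a * p n‖) atTop (𝓝 0)

lemma IsCentralProjectionSeq.mop {A : Type*} [CStarAlgebra A] {p : ℕ → A}
    (hp : IsCentralProjectionSeq p) :
    IsCentralProjectionSeq fun n => MulOpposite.op (p n) where
  bounded := hp.bounded
  star_sub := hp.star_sub
  idem := hp.idem
  central a := (hp.central a.unop).congr fun _ => norm_sub_rev _ _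

lemma IsCentralProjectionSeq.unop {A : Type*} [CStarAlgebra A] {p : ℕ → Aᵐᵒᵖ}
    (hp : IsCentralProjectionSeq p) : IsCentralProjectionSeq fun n => (p n).unop where
  bounded := hp.bounded
  star_sub := hp.star_sub
  idem := hp.idem
  central a := (hp.central (.op a)).congr fun _ => norm_sub_rev _ _

lemma IsCentralProjectionSeq.star_central {A : Type*} [CStarAlgebra A] {p : ℕ → A}
    (hp : IsCentralProjectionSeq p) (a : A) :
    Tendsto (fun n => ‖star (p n) * a - a * star (p n)‖) atTop (𝓝 0) :=
  (hp.central (star a)).congr fun n => by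
    rw [← norm_star, _root_.star_sub, star_mul, star_mul, star_star, norm_sub_rev]

namespace Bimod
variable {A B X : Type u} [CStarAlgebra A] [CStarAlgebra B] [AddCommGroup X] [Module ℂ X]
  {bm : Bimod A B X}

/-- The sequences `p` and `q` asymptotically act in the same way on the bimodule. -/
def Intertwines (bm : Bimod A B X) (p : ℕ → A) (q : ℕ → B) : Prop :=
  ∀ x, bm.IsNull fun n => bm.ls (p n) x - bm.rs x (q n)

lemma intertwines_sum_rinn (h : bm.IsEquivalence) {k : ℕ} {x y : Fin k → X}
    (hxy : ∑ i, bm.rinn (x i) (y i) = 1) {p : ℕ → A}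
    (hp : ∀ a : A, Tendsto (fun n => ‖p n * a - a * p n‖) atTop (𝓝 0)) :
    bm.Intertwines p fun n => ∑ i, bm.rinn (x i) (bm.ls (p n) (y i)) := by
  intro z
  have hz₀ : ∑ i, bm.ls (bm.linn z (x i)) (y i) = z := by
    simp only [h.1, ← rsₗ_apply]
    rw [← map_sum, hxy, rsₗ_apply, bm.rs_one]
  have hz₁ : ∀ n, bm.rs z (∑ i, bm.rinn (x i) (bm.ls (p n) (y i)))
      = ∑ i, bm.ls (bm.linn z (x i)) (bm.ls (p n) (y i)) := fun n => by
    simp only [h.1, ← rsₗ_apply, map_sum]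
  have hz₂ : ∀ n, bm.ls (p n) z = ∑ i, bm.ls (p n) (bm.ls (bm.linn z (x i)) (y i)) := fun n => by
    simp only [← lsₗ_apply (a := p n), ← map_sum, hz₀]
  have hz : ∀ n, bm.ls (p n) z - bm.rs z (∑ i, bm.rinn (x i) (bm.ls (p n) (y i)))
      = ∑ i, bm.ls (p n * bm.linn z (x i) - bm.linn z (x i) * p n) (y i) := fun n => by
    simp only [hz₁, hz₂, bm.ls_sub, bm.ls_mul, Finset.sum_sub_distrib]
  simp only [hz]
  exact IsNull.sum _ fun i _ => isNull_ls (hp _) _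

lemma Intertwines.isCentralProjectionSeq (h : bm.IsEquivalence) {p : ℕ → A} {q : ℕ → B}
    (hpq : bm.Intertwines p q)
    (hpq' : bm.Intertwines (fun n => star (p n)) fun n => star (q n))
    (hp : IsCentralProjectionSeq p) (hq : ∃ M, ∀ n, ‖q n‖ ≤ M) : IsCentralProjectionSeq q where
  bounded := hq
  star_sub := tendsto_norm_of_isNull_rs h fun x => by
    convert ((hpq x).sub (hpq' x)).add (isNull_ls (bm := bm) hp.star_sub x) using 2 with n
    rw [bm.ls_sub, bm.rs_sub]
    abel
  idem := tendsto_norm_of_isNull_rs h fun x => by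
    obtain ⟨M, hM⟩ := hp.bounded
    obtain ⟨M', hM'⟩ := hq
    convert (((isNull_ls (bm := bm) hp.idem x).sub ((hpq x).ls hM)).sub
      ((hpq x).rs hM')).add (hpq x) using 2 with n
    rw [bm.ls_sub, bm.rs_sub, bm.rs_sub', bm.ls_sub', bm.rs_mul, bm.ls_mul, bm.ls_rs]
    abel
  central b := tendsto_norm_of_isNull_rs h fun x => by
    convert (hpq (bm.rs x b)).sub ((hpq x).rs fun _ => le_refl ‖b‖) using 2 with n
    rw [bm.rs_sub, bm.rs_sub', bm.rs_mul, bm.rs_mul, bm.ls_rs]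
    abel

lemma exists_intertwines (h : bm.IsEquivalence) {p : ℕ → A} (hp : IsCentralProjectionSeq p) :
    ∃ q : ℕ → B, IsCentralProjectionSeq q ∧ bm.Intertwines p q := by
  obtain ⟨k, x, y, hxy⟩ := exists_sum_rinn_eq_one h
  have hyx : ∑ i, bm.rinn (y i) (x i) = 1 := by
    simpa [bm.rinn_star] using congrArg star hxy
  have hpq := intertwines_sum_rinn h hxy hp.central
  refine ⟨_, hpq.isCentralProjectionSeq h ?_ hp ?_, hpq⟩
  · convert intertwines_sum_rinn h hyx hp.star_central using 2 with n
    simp only [star_sum, bm.rinn_star, bm.rinn_ls]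
  · obtain ⟨M, hM⟩ := hp.bounded
    refine ⟨∑ i, √(‖bm.linn (x i) (x i)‖ * (M ^ 2 * ‖bm.linn (y i) (y i)‖)), fun n =>
      norm_sum_le_of_le _ fun i _ => Real.le_sqrt_of_sq_le ((norm_rinn_sq_le h _ _).trans ?_)⟩
    refine mul_le_mul_of_nonneg_left ((bm.norm_linn_ls_self_le _ _).trans ?_) (norm_nonneg _)
    exact mul_le_mul_of_nonneg_right (pow_le_pow_left₀ (norm_nonneg _) (hM n) 2) (norm_nonneg _)

lemma exists_intertwines' (h : bm.IsEquivalence) {q : ℕ → B} (hq : IsCentralProjectionSeq q) :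
    ∃ p : ℕ → A, IsCentralProjectionSeq p ∧ bm.Intertwines p q := by
  obtain ⟨p, hp, hqp⟩ := exists_intertwines h.op hq.mop
  refine ⟨_, hp.unop, fun x => ?_⟩
  convert ((isNull_op_iff h).mp (hqp x)).smul (-1) using 2 with n
  rw [neg_smul, one_smul, neg_sub]
  rfl

lemma Intertwines.tendsto_right (h : bm.IsEquivalence) {p : ℕ → A} {q : ℕ → B}
    (hpq : bm.Intertwines p q) {c : ℂ}
    (hp : Tendsto (fun n => ‖p n - c • 1‖) atTop (𝓝 0)) :
    Tendsto (fun n => ‖q n - c • 1‖) atTop (𝓝 0) :=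
  tendsto_norm_of_isNull_rs h fun x => by
    convert (isNull_ls (bm := bm) hp x).sub (hpq x) using 2 with n
    rw [bm.ls_sub, bm.rs_sub, bm.ls_smul, bm.rs_smul, bm.ls_one, bm.rs_one]
    abel

lemma Intertwines.tendsto_left (h : bm.IsEquivalence) {p : ℕ → A} {q : ℕ → B}
    (hpq : bm.Intertwines p q) {c : ℂ}
    (hq : Tendsto (fun n => ‖q n - c • 1‖) atTop (𝓝 0)) :
    Tendsto (fun n => ‖p n - c • 1‖) atTop (𝓝 0) := by
  refine Intertwines.tendsto_right h.op (p := fun n => .op (q n)) (q := fun n => .op (p n))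
    (fun x => (isNull_op_iff h).mpr ?_) hq
  convert (hpq x).smul (-1) using 2 with n
  rw [neg_smul, one_smul, neg_sub]
  rfl

end Bimod

/-! ### Coactions preserve null sequences -/

section Null
variable {H0 : Type u} [CStarAlgebra H0] [FiniteDimensional ℂ H0]
variable {A B X : Type u} [CStarAlgebra A] [CStarAlgebra B] [AddCommGroup X] [Module ℂ X]

/-- The slice of a coaction by a positive trace maps `a⋆a` to a sum of squares. -/
lemma appRight_regularTrace_star_mul_self {ι : Type*} [Fintype ι] [DecidableEq ι]
    {b : Module.Basis ι ℂ H0}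
    (hb : ∀ i j, regularTrace H0 (star (b i) * b j) = if i = j then 1 else 0)
    {ε0 : H0 →ₗ[ℂ] ℂ} {ρ : A →ₗ[ℂ] A ⊗[ℂ] H0} (hρ : IsWeakCoaction ε0 ρ) (a : A) :
    appRight (regularTrace H0) (ρ (star a * a))
      = ∑ i, star (appRight (b.coord i) (ρ a)) * appRight (b.coord i) (ρ a) := by
  rw [hρ.map_mul, hρ.map_star]
  conv_lhs => rw [← sum_appRight_coord_tmul b (ρ a)]
  rw [tstarWith_sum_tmul, Finset.sum_mul_sum]
  simp [hb]

lemma norm_appRight_regularTrace_le {ε0 : H0 →ₗ[ℂ] ℂ} {ρ : A →ₗ[ℂ] A ⊗[ℂ] H0}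
    (hρ : IsWeakCoaction ε0 ρ) (a : A) :
    ‖appRight (regularTrace H0) (ρ (star a * a))‖
      ≤ ‖appRight (regularTrace H0) (ρ 1)‖ * ‖star a * a‖ := by
  obtain ⟨b, hb⟩ := exists_tracial_orthonormal_basis (C := H0)
  obtain ⟨s, hs⟩ := exists_star_mul_self_add_eq a
  have h := norm_sum_star_mul_self_le_norm_add (fun i => appRight (b.coord i) (ρ a))
    fun i => appRight (b.coord i) (ρ s)
  rw [← appRight_regularTrace_star_mul_self hb hρ, ← appRight_regularTrace_star_mul_self hb hρ,
    ← map_add, ← map_add, hs, map_smul, map_smul, norm_smul] at h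
  refine h.trans_eq ?_
  rw [CStarRing.norm_star_mul_self, Complex.norm_real, Real.norm_of_nonneg (by positivity), sq,
    mul_comm]

lemma appRight_regularTrace_linn {ι : Type*} [Fintype ι] [DecidableEq ι]
    {b : Module.Basis ι ℂ H0}
    (hb : ∀ i j, regularTrace H0 (star (b i) * b j) = if i = j then 1 else 0)
    {bm : Bimod A B X} (s t : X ⊗[ℂ] H0) :
    appRight (regularTrace H0) (tinnL bm.linn s t)
      = ∑ i, bm.linn (appRight (b.coord i) s) (appRight (b.coord i) t) := by
  let cop : H0 →ₗ[ℂ] H0 →ₛₗ[starRingEnd ℂ] H0 :=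
    LinearMap.mk₂'ₛₗ _ _ (fun c d => c * star d) (fun _ _ _ => add_mul _ _ _)
      (fun _ _ _ => smul_mul_assoc _ _ _) (fun _ _ _ => by rw [star_add, mul_add])
      (fun _ _ _ => by rw [star_smul, mul_smul_comm]; rfl)
  have h : tinnL bm.linn s t = TensorProduct.map₂ bm.linnₗ cop s t :=
    tmix_eq_map₂ bm.linnₗ cop s t
  have hcop : ∀ i j, regularTrace H0 (cop (b i) (b j)) = if j = i then 1 else 0 := fun i j => by
    rw [← hb, regularTrace_mul_comm]
    rfl
  rw [h]
  conv_lhs => rw [← sum_appRight_coord_tmul b s, ← sum_appRight_coord_tmul b t]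
  simp [LinearMap.sum_apply, hcop]

variable {bm : Bimod A B X} {ε0 : H0 →ₗ[ℂ] ℂ} {ρ : A →ₗ[ℂ] A ⊗[ℂ] H0}
  {σ : B →ₗ[ℂ] B ⊗[ℂ] H0} {lam : X →ₗ[ℂ] X ⊗[ℂ] H0}

lemma norm_linn_coord_le {ι : Type*} [Fintype ι] [DecidableEq ι] {b : Module.Basis ι ℂ H0}
    (hb : ∀ i j, regularTrace H0 (star (b i) * b j) = if i = j then 1 else 0)
    (hρ : IsWeakCoaction ε0 ρ) (hlam : IsWeakCoactionBimod ε0 bm ρ σ lam) (i : ι) (x : X) :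
    ‖bm.linn (appRight (b.coord i) (lam x)) (appRight (b.coord i) (lam x))‖
      ≤ ‖appRight (regularTrace H0) (ρ 1)‖ * ‖bm.linn x x‖ := by
  obtain ⟨a, ha⟩ := bm.linn_pos x
  choose c hc using fun j => bm.linn_pos (appRight (b.coord j) (lam x))
  have h := norm_appRight_regularTrace_le hρ a
  rw [← ha, hlam.linn_compat, appRight_regularTrace_linn hb] at h
  refine le_trans ?_ h
  have h₁ := norm_sum_star_mul_self_le_norm_add (fun _ : Unit => c i)
    fun j : {j // j ≠ i} => c j
  simp only [← hc, Finset.univ_unique, Finset.sum_singleton] at h₁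
  refine h₁.trans_eq (congrArg norm ?_)
  rw [← Finset.add_sum_erase _ _ (Finset.mem_univ i)]
  congr 1
  symm
  exact Finset.sum_subtype (Finset.univ.erase i) (by simp) _

lemma Bimod.IsNull.appRight_coaction (hρ : IsWeakCoaction ε0 ρ)
    (hlam : IsWeakCoactionBimod ε0 bm ρ σ lam) {w : ℕ → X} (hw : bm.IsNull w)
    (f : H0 →ₗ[ℂ] ℂ) : bm.IsNull fun n => appRight f (lam (w n)) := by
  obtain ⟨b, hb⟩ := exists_tracial_orthonormal_basis (C := H0)
  have hf : ∀ x, appRight f (lam x) = ∑ i, f (b i) • appRight (b.coord i) (lam x) := fun x => by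
    conv_lhs => rw [← sum_appRight_coord_tmul b (lam x)]
    simp
  simp only [hf]
  refine IsNull.sum _ fun i _ => IsNull.smul ?_ _
  exact squeeze_zero (fun _ => norm_nonneg _) (fun n => norm_linn_coord_le hb hρ hlam i (w n))
    (by simpa using Tendsto.const_mul ‖appRight (regularTrace H0) (ρ 1)‖ hw)

lemma Bimod.Intertwines.coactAct_haar {H : Type u} [CStarAlgebra H] [FiniteDimensional ℂ H]
    {dp : HopfPairData H H0} (hρ : IsWeakCoaction dp.dH0.counit.toLinearMap ρ)
    (hlam : IsCoactionBimod dp.dH0.comul.toLinearMap dp.dH0.counit.toLinearMap bm ρ σ lam)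
    {p : ℕ → A} {q : ℕ → B} (hpq : bm.Intertwines p q) :
    bm.Intertwines (fun n => coactAct dp ρ dp.haar (p n))
      fun n => coactAct dp σ dp.haar (q n) := by
  intro x
  obtain ⟨k, x₀, x₁, hx⟩ := exists_fin_sum_tmul (lam x)
  simp only [coactAct_haar_sub hlam _ _ hx]
  exact IsNull.sum _ fun i _ =>
    (hpq (x₀ i)).appRight_coaction hρ hlam.toIsWeakCoactionBimod _

end Null

/-- **Main theorem.** Let `H` be a finite dimensional C*-Hopf algebra with dual
C*-Hopf algebra `H0`, and let `ρ` and `σ` be coactions of `H0` on unital C*-algebras `A` and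
`B` respectively.  If `ρ` is strongly Morita equivalent to `σ`, then `ρ` has the Rohlin
property if and only if `σ` has the Rohlin property. -/
theorem rohlin_property_of_strong_morita_equivalence
    {H H0 : Type u} [CStarAlgebra H] [StarModule ℂ H] [FiniteDimensional ℂ H]
    [CStarAlgebra H0] [StarModule ℂ H0] [FiniteDimensional ℂ H0]
    {A B : Type u} [CStarAlgebra A] [StarModule ℂ A] [CStarAlgebra B] [StarModule ℂ B]
    (dp : HopfPairData H H0)
    (ρ : A →ₗ[ℂ] A ⊗[ℂ] H0) (σ : B →ₗ[ℂ] B ⊗[ℂ] H0)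
    (hρ : IsCoaction dp.dH0.comul.toLinearMap dp.dH0.counit.toLinearMap ρ)
    (hσ : IsCoaction dp.dH0.comul.toLinearMap dp.dH0.counit.toLinearMap σ)
    (hSME : CoactSME dp.dH0.comul.toLinearMap dp.dH0.counit.toLinearMap ρ σ) :
    RohlinProperty dp ρ ↔ RohlinProperty dp σ := by
  obtain ⟨X, _, _, bm, h, lam, hlam⟩ := hSME
  constructor
  · rintro ⟨p, hb, hs, hi, hc, he⟩
    obtain ⟨q, hq, hpq⟩ := Bimod.exists_intertwines h ⟨hb, hs, hi, hc⟩
    exact ⟨q, hq.bounded, hq.star_sub, hq.idem, hq.central,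
      (hpq.coactAct_haar hρ.toIsWeakCoaction hlam).tendsto_right h he⟩
  · rintro ⟨q, hb, hs, hi, hc, he⟩
    obtain ⟨p, hp, hpq⟩ := Bimod.exists_intertwines' h ⟨hb, hs, hi, hc⟩
    exact ⟨p, hp.bounded, hp.star_sub, hp.idem, hp.central,
      (hpq.coactAct_haar hρ.toIsWeakCoaction hlam).tendsto_left h he⟩

end SMEPaper
end
end

section
/- Let H be a finite dimensional C*-Hopf algebra of dimension N with dual C*-Hopf algebra H^0, let A be a UHF-algebra of type N^∞, and suppose ρ is a coaction of H^0 on A with the Rohlin property (such a coaction exists). Then for every unital C*-algebra B that is strongly Morita equivalent to A, there exists a coaction σ of H^0 on B with the Rohlin property. -/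
open scoped TensorProduct
open Filter Topology
set_option maxHeartbeats 1000000
set_option linter.unusedSectionVars false
set_option synthInstance.maxHeartbeats 400000
noncomputable section
namespace SMEPaper
universe u

/-! ### Matrix algebras -/

section MatrixAlgebras
variable {m n : Type*} [Fintype m] [DecidableEq m] [Fintype n] [DecidableEq n]

theorem trace_algHom (α : Matrix m m ℂ →ₐ[ℂ] Matrix n n ℂ) (x : Matrix m m ℂ) :
    (Fintype.card m : ℂ) * (α x).trace = Fintype.card n * x.trace := by
  have key : ∑ i : m, ∑ j : m, Matrix.single i j (1 : ℂ) * x * Matrix.single j i 1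
      = x.trace • (1 : Matrix m m ℂ) := by
    simp only [Matrix.single_mul_mul_single, one_mul, mul_one]
    rw [Matrix.smul_one_eq_diagonal]
    ext a b
    simp only [Matrix.sum_apply, Matrix.single_apply, Matrix.diagonal_apply, Matrix.trace,
      Matrix.diag]
    by_cases h : a = b
    · subst h; simp
    · simp only [h, if_false]
      refine Finset.sum_eq_zero fun i _ => Finset.sum_eq_zero fun j _ => if_neg ?_
      rintro ⟨rfl, rfl⟩; exact h rfl
  have h2 : ∀ i j : m, (α (Matrix.single i j (1 : ℂ) * x * Matrix.single j i 1)).trace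
      = (α (Matrix.single j j 1 * x)).trace := by
    intro i j
    rw [map_mul, Matrix.trace_mul_comm, ← map_mul, ← mul_assoc, Matrix.single_mul_single_same,
      one_mul]
  have h3 := congrArg (fun y => (α y).trace) key
  simp only [map_sum, Matrix.trace_sum, h2, map_smul, map_one, Matrix.trace_smul,
    Matrix.trace_one] at h3
  rw [← Matrix.trace_sum, ← map_sum, ← Finset.sum_mul, Matrix.sum_single_one, one_mul] at h3
  simpa [mul_comm] using h3

/-- A projection in a matrix algebra factors through an isometry. -/
theorem exists_isometry_of_isStarProjection {P : Matrix n n ℂ} (hP : IsStarProjection P) :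
    ∃ (r : ℕ) (W : Matrix n (Fin r) ℂ), W.conjTranspose * W = 1 ∧ W * W.conjTranspose = P := by
  have hH : P.IsHermitian := hP.isSelfAdjoint
  set U := (hH.eigenvectorUnitary : Matrix n n ℂ)
  have hUU : star U * U = 1 := Unitary.coe_star_mul_self hH.eigenvectorUnitary
  have hPU : P = U * Matrix.diagonal (RCLike.ofReal ∘ hH.eigenvalues) * star U := by
    conv_lhs => rw [hH.spectral_theorem]
    rfl
  set D : Matrix n n ℂ := Matrix.diagonal (RCLike.ofReal ∘ hH.eigenvalues) with hD
  have hDU : D = star U * P * U := by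
    rw [hPU, mul_assoc, mul_assoc, mul_assoc, hUU, mul_one, ← mul_assoc, hUU, one_mul]
  have hDD : D * D = D := by
    have hUU' : U * star U = 1 := Unitary.coe_mul_star_self hH.eigenvectorUnitary
    calc D * D = star U * P * (U * star U) * P * U := by
          nth_rw 1 2 [hDU]; simp only [mul_assoc]
      _ = star U * (P * P) * U := by rw [hUU', mul_one]; simp only [mul_assoc]
      _ = D := by rw [hP.isIdempotentElem.eq, ← hDU]
  have hev : ∀ i, hH.eigenvalues i = 0 ∨ hH.eigenvalues i = 1 := by
    intro i
    have h := congrFun (congrFun hDD i) i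
    rw [hD, Matrix.diagonal_mul_diagonal, Matrix.diagonal_apply_eq, Matrix.diagonal_apply_eq] at h
    have h' : hH.eigenvalues i * hH.eigenvalues i = hH.eigenvalues i := by
      simp only [Function.comp_apply] at h
      exact_mod_cast h
    rcases eq_or_ne (hH.eigenvalues i) 0 with h0 | h0
    · exact .inl h0
    · exact .inr (mul_left_cancel₀ h0 (by rw [h', mul_one]))
  let s := {i // hH.eigenvalues i = 1}
  let e : Fin (Fintype.card s) ≃ s := (Fintype.equivFin s).symm
  refine ⟨Fintype.card s, U.submatrix id fun k => (e k : n), ?_, ?_⟩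
  · ext a b
    have h := congrFun (congrFun hUU (e a)) (e b)
    rw [Matrix.mul_apply, Matrix.one_apply] at h
    rw [Matrix.mul_apply, Matrix.one_apply]
    simpa [Subtype.ext_iff.symm, Matrix.star_apply] using h
  · conv_rhs => rw [hPU]
    ext a b
    rw [Matrix.mul_apply, Matrix.mul_apply]
    simp only [hD, Matrix.mul_diagonal, Matrix.submatrix_apply, id, Matrix.conjTranspose_apply,
      Matrix.star_apply, Function.comp]
    rw [e.sum_comp (fun k : s => U a k * star (U b k)),
      ← Finset.sum_subtype (Finset.univ.filter fun i => hH.eigenvalues i = 1) (by simp)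
        (fun k => U a k * star (U b k)), Finset.sum_filter]
    refine Finset.sum_congr rfl fun k _ => ?_
    rcases hev k with h | h <;> simp [h]

/-- Two unital star homomorphisms between full matrix algebras are unitarily equivalent. -/
theorem exists_unitary_intertwining (α β : Matrix m m ℂ →⋆ₐ[ℂ] Matrix n n ℂ) :
    ∃ u ∈ unitary (Matrix n n ℂ), ∀ x, β x * u = u * α x := by
  rcases isEmpty_or_nonempty m with hm | ⟨⟨o⟩⟩
  · refine ⟨1, one_mem _, fun x => ?_⟩
    rw [Subsingleton.elim x 0]; simp
  let E : m → m → Matrix m m ℂ := fun i j => Matrix.single i j 1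
  have hEE : ∀ i j k, E i j * E j k = E i k := fun i j k => by
    simp [E]
  have hEne : ∀ i j k l, j ≠ k → E i j * E k l = 0 := fun i j k l h => by
    simp [E, h]
  have hEs : ∀ i j, star (E i j) = E j i := fun i j => by
    simp [E, Matrix.star_eq_conjTranspose]
  have hE1 : ∑ i, E i i = 1 := Matrix.sum_single_one
  have hproj : ∀ γ : Matrix m m ℂ →⋆ₐ[ℂ] Matrix n n ℂ, IsStarProjection (γ (E o o)) := fun γ =>
    ⟨by rw [IsIdempotentElem, ← map_mul, hEE], by rw [IsSelfAdjoint, ← map_star, hEs]⟩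
  obtain ⟨r, V, hV, hV'⟩ := exists_isometry_of_isStarProjection (hproj α)
  obtain ⟨s, W, hW, hW'⟩ := exists_isometry_of_isStarProjection (hproj β)
  have hrank : ∀ (γ : Matrix m m ℂ →⋆ₐ[ℂ] Matrix n n ℂ) (t : ℕ) (Z : Matrix n (Fin t) ℂ),
      Z.conjTranspose * Z = 1 → Z * Z.conjTranspose = γ (E o o) →
      (Fintype.card m : ℂ) * t = Fintype.card n := by
    intro γ t Z h h'
    have := trace_algHom γ.toAlgHom (E o o)
    have h2 : (γ (E o o)).trace = t := by
      rw [← h', Matrix.trace_mul_comm, h, Matrix.trace_one, Fintype.card_fin]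
    have h3 : (E o o).trace = 1 := by simp [E]
    rw [h3, mul_one] at this
    rw [← h2]; exact this
  have hrs : r = s := by
    have h1 := hrank α r V hV hV'
    rw [← hrank β s W hW hW'] at h1
    have h0 : (Fintype.card m : ℂ) ≠ 0 := by
      have : Nonempty m := ⟨o⟩
      exact_mod_cast Fintype.card_ne_zero
    exact_mod_cast mul_left_cancel₀ h0 h1
  subst hrs
  let v := W * V.conjTranspose
  have hv : v * α (E o o) * star v = β (E o o) := by
    rw [← hV', ← hW', Matrix.star_eq_conjTranspose]
    simp only [v, Matrix.conjTranspose_mul, Matrix.conjTranspose_conjTranspose]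
    calc W * V.conjTranspose * (V * V.conjTranspose) * (V * W.conjTranspose)
        = W * (V.conjTranspose * V) * (V.conjTranspose * V) * W.conjTranspose := by
          simp only [Matrix.mul_assoc]
      _ = _ := by simp [hV]
  let w := ∑ i, β (E i o) * v * α (E o i)
  have hww : w * star w = 1 := by
    have : ∀ i j, (β (E i o) * v * α (E o i)) * star (β (E j o) * v * α (E o j))
        = if i = j then β (E i i) else 0 := by
      intro i j
      rw [star_mul, star_mul, ← map_star, ← map_star, hEs, hEs]
      have h1 : (β (E i o) * v * α (E o i)) * (α (E j o) * (star v * β (E o j)))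
          = β (E i o) * (v * α (E o i * E j o) * star v) * β (E o j) := by
        rw [map_mul]; simp only [mul_assoc]
      rw [h1]
      split_ifs with h
      · subst h
        rw [hEE, hv, ← map_mul, ← map_mul, hEE, hEE]
      · rw [hEne _ _ _ _ h]; simp
    simp only [w, star_sum, Finset.sum_mul, Finset.mul_sum, this]
    simp [← map_sum, hE1]
  refine ⟨w, Unitary.mem_iff.2 ⟨mul_eq_one_comm.1 hww, hww⟩, fun x => ?_⟩
  have hE : ∀ k l, β (E k l) * w = w * α (E k l) := by
    intro k l
    have h1 : β (E k l) * w = β (E k o) * v * α (E o l) := by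
      simp only [w, Finset.mul_sum]
      rw [Finset.sum_eq_single l]
      · rw [← mul_assoc, ← mul_assoc, ← map_mul, hEE]
      · intro i _ hi
        rw [← mul_assoc, ← mul_assoc, ← map_mul, hEne _ _ _ _ hi.symm]; simp
      · simp
    have h2 : w * α (E k l) = β (E k o) * v * α (E o l) := by
      simp only [w, Finset.sum_mul]
      rw [Finset.sum_eq_single k]
      · rw [mul_assoc, ← map_mul, hEE]
      · intro i _ hi
        rw [mul_assoc, ← map_mul, hEne _ _ _ _ hi]; simp
      · simp
    rw [h1, h2]
  have hx : x = ∑ i, ∑ j, x i j • E i j := by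
    conv_lhs => rw [Matrix.matrix_eq_sum_single x]
    simp [E, Matrix.smul_single]
  rw [hx]
  simp only [map_sum, map_smul, Finset.sum_mul, Finset.mul_sum, smul_mul_assoc, mul_smul_comm, hE]

end MatrixAlgebras

/-! ### Uniqueness of inductive limits of full matrix algebras -/

section InductiveLimits
variable {C D : Type*} [CStarAlgebra C] [CStarAlgebra D]

/-- An increasing sequence of unital star subalgebras of `C`, the `k`-th one isomorphic to
the algebra of matrices of size `d k`, with dense union. -/
structure IsMatrixFiltration (F : ℕ → StarSubalgebra ℂ C) (d : ℕ → ℕ) : Prop where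
  mono : Monotone F
  equiv : ∀ k, Nonempty (F k ≃⋆ₐ[ℂ] Matrix (Fin (d k)) (Fin (d k)) ℂ)
  dense : ∀ (c : C) (ε : ℝ), 0 < ε → ∃ k, ∃ x ∈ F k, ‖c - x‖ < ε

theorem isClosed_of_equiv_matrix {S : StarSubalgebra ℂ C} {r : ℕ}
    (e : S ≃⋆ₐ[ℂ] Matrix (Fin r) (Fin r) ℂ) : IsClosed (S : Set C) := by
  have : FiniteDimensional ℂ S.toSubalgebra.toSubmodule :=
    LinearEquiv.finiteDimensional (V := Matrix (Fin r) (Fin r) ℂ)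
      (e.toAlgEquiv.toLinearEquiv.symm : _ ≃ₗ[ℂ] S)
  exact S.toSubalgebra.toSubmodule.closed_of_finiteDimensional

theorem norm_starAlgEquiv_of_isClosed {S : StarSubalgebra ℂ C} {T : StarSubalgebra ℂ D}
    (hS : IsClosed (S : Set C)) (hT : IsClosed (T : Set D)) (φ : S ≃⋆ₐ[ℂ] T) (x : S) :
    ‖(φ x : D)‖ = ‖(x : C)‖ :=
  NonUnitalStarAlgHom.norm_map φ φ.injective x

/-- An isomorphism between the `k`-th subalgebras extends to the next ones. -/
theorem IsMatrixFiltration.exists_extension {d : ℕ → ℕ} {F : ℕ → StarSubalgebra ℂ C}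
    {G : ℕ → StarSubalgebra ℂ D} (hF : IsMatrixFiltration F d) (hG : IsMatrixFiltration G d)
    (k : ℕ) (φ : F k ≃⋆ₐ[ℂ] G k) :
    ∃ ψ : F (k + 1) ≃⋆ₐ[ℂ] G (k + 1), ∀ (x : F k) (y : F (k + 1)), (y : C) = x →
      (ψ y : D) = φ x := by
  obtain ⟨a⟩ := hF.equiv (k + 1)
  obtain ⟨b⟩ := hG.equiv (k + 1)
  obtain ⟨c⟩ := hF.equiv k
  let i : F k →⋆ₐ[ℂ] F (k + 1) := StarSubalgebra.inclusion (hF.mono k.le_succ)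
  let j : G k →⋆ₐ[ℂ] G (k + 1) := StarSubalgebra.inclusion (hG.mono k.le_succ)
  let c' : Matrix (Fin (d k)) (Fin (d k)) ℂ →⋆ₐ[ℂ] F k := c.symm
  let a' : F (k + 1) →⋆ₐ[ℂ] Matrix (Fin (d (k + 1))) (Fin (d (k + 1))) ℂ := a
  let b' : G (k + 1) →⋆ₐ[ℂ] Matrix (Fin (d (k + 1))) (Fin (d (k + 1))) ℂ := b
  let φ' : F k →⋆ₐ[ℂ] G k := φ
  obtain ⟨u, hu, h⟩ := exists_unitary_intertwining ((a'.comp i).comp c')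
    (((b'.comp j).comp φ').comp c')
  refine ⟨(a.trans (Unitary.conjStarAlgAut ℂ _ ⟨u, hu⟩)).trans b.symm, fun x y hxy => ?_⟩
  have hy : y = i x := Subtype.ext hxy
  have h1 := h (c x)
  change b (j (φ (c.symm (c x)))) * u = u * a (i (c.symm (c x))) at h1
  rw [StarAlgEquiv.symm_apply_apply] at h1
  have h2 : b.symm (u * a y * star u) = j (φ x) := by
    rw [StarAlgEquiv.symm_apply_eq, hy, ← h1, mul_assoc, (Unitary.mem_iff.1 hu).2, mul_one]
  exact congrArg Subtype.val h2

theorem bijective_of_isometry_of_dense {E F 𝓕 : Type*} [NormedAddCommGroup E] [CompleteSpace E]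
    [NormedAddCommGroup F] [FunLike 𝓕 E F] (f : 𝓕) (hf : Isometry f)
    (hd : ∀ (y : F) (ε : ℝ), 0 < ε → ∃ x, ‖y - f x‖ < ε) : Function.Bijective f := by
  refine ⟨hf.injective, fun y => ?_⟩
  have hc : IsClosed (Set.range f) := hf.isClosedEmbedding.isClosed_range
  have : y ∈ closure (Set.range f) := Metric.mem_closure_iff.2 fun ε hε => by
    obtain ⟨x, hx⟩ := hd y ε hε
    exact ⟨f x, ⟨x, rfl⟩, by rwa [dist_eq_norm]⟩
  rwa [hc.closure_eq] at this

/-- **Glimm's theorem**: the sizes of the matrix algebras in a matrix filtration determine the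
C*-algebra. -/
theorem IsMatrixFiltration.nonempty_starAlgEquiv {d : ℕ → ℕ} {F : ℕ → StarSubalgebra ℂ C}
    {G : ℕ → StarSubalgebra ℂ D} (hF : IsMatrixFiltration F d) (hG : IsMatrixFiltration G d) :
    Nonempty (C ≃⋆ₐ[ℂ] D) := by
  choose ext hext using hF.exists_extension hG
  let φ : ∀ k, F k ≃⋆ₐ[ℂ] G k := fun k =>
    Nat.rec ((hF.equiv 0).some.trans (hG.equiv 0).some.symm) ext k
  have hφ : ∀ k l, k ≤ l → ∀ (x : F k) (y : F l), (y : C) = x → (φ l y : D) = φ k x := by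
    intro k l hkl
    induction l, hkl using Nat.le_induction with
    | base => intro x y h; rw [Subtype.ext h]
    | succ l hkl ih =>
      intro x y h
      have hx : (x : C) ∈ F l := hF.mono hkl x.2
      rw [← ih x ⟨x, hx⟩ rfl]
      exact hext l (φ l) ⟨x, hx⟩ y h
  have hnorm : ∀ k (x : F k), ‖(φ k x : D)‖ = ‖(x : C)‖ := fun k x =>
    norm_starAlgEquiv_of_isClosed (isClosed_of_equiv_matrix (hF.equiv k).some)
      (isClosed_of_equiv_matrix (hG.equiv k).some) (φ k) x
  have hcommon : ∀ {z w : C × D}, (∃ k, ∃ x : F k, z = (↑x, ↑(φ k x))) →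
      (∃ k, ∃ x : F k, w = (↑x, ↑(φ k x))) →
      ∃ k, ∃ x y : F k, z = (↑x, ↑(φ k x)) ∧ w = (↑y, ↑(φ k y)) := by
    rintro _ _ ⟨k, x, rfl⟩ ⟨l, y, rfl⟩
    refine ⟨max k l, ⟨x, hF.mono (le_max_left k l) x.2⟩,
      ⟨y, hF.mono (le_max_right k l) y.2⟩, ?_, ?_⟩
    · rw [hφ k _ (le_max_left k l) x _ rfl]
    · rw [hφ l _ (le_max_right k l) y _ rfl]
  let S : StarSubalgebra ℂ (C × D) :=
    { carrier := {z | ∃ k, ∃ x : F k, z = (↑x, ↑(φ k x))}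
      mul_mem' := fun hz hw => by
        obtain ⟨k, x, y, rfl, rfl⟩ := hcommon hz hw
        exact ⟨k, x * y, by simp⟩
      add_mem' := fun hz hw => by
        obtain ⟨k, x, y, rfl, rfl⟩ := hcommon hz hw
        exact ⟨k, x + y, by simp⟩
      algebraMap_mem' := fun c => ⟨0, algebraMap ℂ (F 0) c, by
        rw [Algebra.algebraMap_eq_smul_one, Algebra.algebraMap_eq_smul_one, map_smul, map_one]
        rfl⟩
      star_mem' := by
        rintro _ ⟨k, x, rfl⟩
        exact ⟨k, star x, by rw [map_star]; rfl⟩ }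
  let E := S.topologicalClosure
  have hE : ∀ z ∈ E, ‖z.1‖ = ‖z.2‖ := by
    have hcl : IsClosed {z : C × D | ‖z.1‖ = ‖z.2‖} :=
      isClosed_eq (by fun_prop) (by fun_prop)
    have hsub : (S : Set (C × D)) ⊆ {z | ‖z.1‖ = ‖z.2‖} := by
      rintro _ ⟨k, x, rfl⟩
      exact (hnorm k x).symm
    exact fun z hz => closure_minimal hsub hcl hz
  have : CompleteSpace E := (S.isClosed_topologicalClosure).completeSpace_coe
  let f : E →⋆ₐ[ℂ] C := (StarAlgHom.fst ℂ C D).comp E.subtype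
  let g : E →⋆ₐ[ℂ] D := (StarAlgHom.snd ℂ C D).comp E.subtype
  have hf : Isometry f := AddMonoidHomClass.isometry_of_norm f fun z => by
    change ‖z.1.1‖ = max ‖z.1.1‖ ‖z.1.2‖
    rw [hE z.1 z.2, max_self]
  have hg : Isometry g := AddMonoidHomClass.isometry_of_norm g fun z => by
    change ‖z.1.2‖ = max ‖z.1.1‖ ‖z.1.2‖
    rw [hE z.1 z.2, max_self]
  have hf' : Function.Bijective f := bijective_of_isometry_of_dense f hf fun c ε hε => by
    obtain ⟨k, x, hx, h⟩ := hF.dense c ε hε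
    exact ⟨⟨(x, φ k ⟨x, hx⟩), S.le_topologicalClosure ⟨k, ⟨x, hx⟩, rfl⟩⟩, h⟩
  have hg' : Function.Bijective g := bijective_of_isometry_of_dense g hg fun c ε hε => by
    obtain ⟨k, y, hy, h⟩ := hG.dense c ε hε
    refine ⟨⟨((φ k).symm ⟨y, hy⟩, y), S.le_topologicalClosure ⟨k, (φ k).symm ⟨y, hy⟩, ?_⟩⟩, h⟩
    rw [StarAlgEquiv.apply_symm_apply]
  exact ⟨(StarAlgEquiv.ofBijective f hf').symm.trans (StarAlgEquiv.ofBijective g hg')⟩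

end InductiveLimits

/-! ### Perturbation of projections -/

section Projections
variable {C : Type*} [CStarAlgebra C]

/-- A projection close to a closed star subalgebra is close to a projection in it. -/
theorem exists_isStarProjection_mem {S : StarSubalgebra ℂ C} (hS : IsClosed (S : Set C))
    {p x : C} (hp : IsStarProjection p) (hx : x ∈ S) (hpx : ‖p - x‖ < 1 / 32) :
    ∃ q ∈ S, IsStarProjection q ∧ ‖p - q‖ < 1 := by
  set a : C := (1 / 2 : ℂ) • (x + star x) with ha
  have haS : a ∈ S := S.smul_mem (add_mem hx (star_mem hx)) _
  have hasa : IsSelfAdjoint a := by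
    simp [ha, IsSelfAdjoint, add_comm]
  have hpa : ‖p - a‖ < 1 / 32 := by
    have h : p - a = (1 / 2 : ℂ) • ((p - x) + star (p - x)) := by
      rw [star_sub, hp.isSelfAdjoint.star_eq, ha]
      module
    rw [h, norm_smul]
    have := norm_add_le (p - x) (star (p - x))
    rw [norm_star] at this
    norm_num at this ⊢
    linarith
  have hp1 : ‖p‖ ≤ 1 := hp.norm_le
  have ha1 : ‖a‖ ≤ 2 := by
    have := norm_sub_norm_le a p
    rw [norm_sub_rev] at this
    linarith
  have haa : ‖a * a - a‖ ≤ 7 / 32 := by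
    have h : a * a - a = (a - p) * a + p * (a - p) + (p - a) := by
      simp only [mul_sub, sub_mul, hp.isIdempotentElem.eq]
      abel
    have hap : ‖a - p‖ < 1 / 32 := by rwa [norm_sub_rev]
    have h1 : ‖(a - p) * a‖ ≤ 1 / 32 * 2 :=
      (norm_mul_le _ _).trans (by gcongr)
    have h2 : ‖p * (a - p)‖ ≤ 1 * (1 / 32) :=
      (norm_mul_le _ _).trans (by gcongr)
    rw [h]
    refine (norm_add₃_le).trans ?_
    linarith
  have hspec : ∀ t ∈ spectrum ℝ a, |t * t - t| ≤ 7 / 32 := by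
    intro t ht
    have h := norm_apply_le_norm_cfc (fun t : ℝ => t * t - t) a ht
    have h2 : cfc (fun t : ℝ => t * t - t) a = a * a - a := by
      rw [cfc_sub (fun t : ℝ => t * t) (fun t => t) a, cfc_mul (fun t : ℝ => t) (fun t => t) a,
        cfc_id' ℝ a]
    rw [h2] at h
    exact h.trans haa
  let f : ℝ → ℝ := fun t => max 0 (min 1 (4 * t - 3 / 2))
  have hf : Continuous f := by fun_prop
  have hdich : ∀ t ∈ spectrum ℝ a, (f t = 0 ∧ |t| ≤ 3 / 8) ∨ (f t = 1 ∧ |t - 1| ≤ 3 / 8) := by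
    intro t ht
    have h := abs_le.1 (hspec t ht)
    rcases le_or_gt t (3 / 8) with h1 | h1
    · left
      refine ⟨max_eq_left ((min_le_right _ _).trans (by linarith)), abs_le.2 ⟨?_, h1⟩⟩
      nlinarith
    · right
      have h2 : 5 / 8 ≤ t := by nlinarith
      refine ⟨?_, abs_le.2 ⟨by linarith, by nlinarith⟩⟩
      simp only [f]
      rw [min_eq_left (by linarith), max_eq_right zero_le_one]
  refine ⟨cfc f a, ?_, ⟨?_, cfc_predicate f a⟩, ?_⟩
  · have : IsClosed (S : Set C) := hS
    exact cfc_mem (𝕜' := ℂ) f haS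
  · rw [IsIdempotentElem, ← cfc_mul f f a]
    refine cfc_congr fun t ht => ?_
    rcases hdich t ht with h | h <;> simp [h.1]
  · have h : ‖a - cfc f a‖ ≤ 3 / 8 := by
      have h2 : a - cfc f a = cfc (fun t => t - f t) a := by
        rw [cfc_sub (fun t : ℝ => t) f a, cfc_id' ℝ a]
      rw [h2]
      refine norm_cfc_le (by norm_num) fun t ht => ?_
      rcases hdich t ht with h | h <;> simp [h.1, h.2]
    have := norm_sub_le_norm_sub_add_norm_sub p a (cfc f a)
    linarith

/-- Two projections at distance less than one are unitarily equivalent. -/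
theorem exists_unitary_of_norm_sub_lt_one {p q : C} (hp : IsStarProjection p)
    (hq : IsStarProjection q) (h : ‖p - q‖ < 1) :
    ∃ u ∈ unitary C, u * p = q * u := by
  let _ := CStarAlgebra.spectralOrder C
  have _ := CStarAlgebra.spectralOrderedRing C
  have hpp : p * p = p := hp.isIdempotentElem.eq
  have hqq : q * q = q := hq.isIdempotentElem.eq
  have hps : star p = p := hp.isSelfAdjoint.star_eq
  have hqs : star q = q := hq.isSelfAdjoint.star_eq
  set z := q * p + (1 - q) * (1 - p) with hz
  have hzs : star z = p * q + (1 - p) * (1 - q) := by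
    simp [hz, hps, hqs]
  have hunit : IsUnit (1 - (p - q) * (p - q)) :=
    isUnit_one_sub_of_norm_lt_one ((norm_mul_le _ _).trans_lt
      (mul_lt_one_of_nonneg_of_lt_one_left (norm_nonneg _) h h.le))
  have hppx : ∀ x, p * (p * x) = p * x := fun x => by rw [← mul_assoc, hpp]
  have hqqx : ∀ x, q * (q * x) = q * x := fun x => by rw [← mul_assoc, hqq]
  have h1 : star z * z = 1 - (p - q) * (p - q) := by
    rw [hzs, hz]
    simp only [mul_sub, sub_mul, mul_add, add_mul, mul_one, one_mul, mul_assoc, hpp, hqq, hqqx]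
    abel
  have h2 : z * star z = 1 - (p - q) * (p - q) := by
    rw [hzs, hz]
    simp only [mul_sub, sub_mul, mul_add, add_mul, mul_one, one_mul, mul_assoc, hpp, hqq, hppx]
    abel
  have hzp : z * p = q * z := by
    rw [hz]
    simp only [mul_sub, sub_mul, mul_add, add_mul, mul_one, one_mul, mul_assoc, hpp, hqq, hqqx]
    abel
  have hcomm : Commute (star z * z) p := by
    rw [h1, Commute, SemiconjBy]
    simp only [mul_sub, sub_mul, mul_one, one_mul, mul_assoc, hpp, hqq, hppx]
    abel
  have hzu : IsUnit z := by
    obtain ⟨w, hw⟩ := hunit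
    refine isUnit_iff_exists_and_exists.2 ⟨⟨star z * ↑w⁻¹, ?_⟩, ⟨↑w⁻¹ * star z, ?_⟩⟩
    · rw [← mul_assoc, h2, ← hw, Units.mul_inv]
    · rw [mul_assoc, h1, ← hw, Units.inv_mul]
  have hpos : IsStrictlyPositive (star z * z) := by
    rw [← h1] at hunit
    exact hunit.isStrictlyPositive (star_mul_self_nonneg z)
  set k := (star z * z) ^ (-(1 / 2) : ℝ) with hk
  have hks : star k = k := (CFC.rpow_nonneg : 0 ≤ k).isSelfAdjoint.star_eq
  have hkk : k * (star z * z) * k = 1 := CFC.conjugate_rpow_neg_one_half _ hpos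
  have hkp : Commute k p := hcomm.cfc_nnreal _
  have hku : IsUnit k :=
    isUnit_iff_exists_and_exists.2 ⟨⟨_, by rw [← mul_assoc, hkk]⟩, ⟨_, hkk⟩⟩
  have huu : star (z * k) * (z * k) = 1 := by
    rw [star_mul, hks, ← hkk]
    simp only [mul_assoc]
  refine ⟨z * k, Unitary.mem_iff.2 ⟨huu, ?_⟩, ?_⟩
  · obtain ⟨w, hw⟩ := hzu.mul hku
    rw [← hw] at huu ⊢
    rw [Units.mul_eq_one_iff_eq_inv.1 huu, Units.mul_inv]
  · rw [mul_assoc, hkp.eq, ← mul_assoc, hzp, mul_assoc]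

end Projections

/-! ### Matrix filtrations of corners and of matrix algebras -/

section Corners
variable {B C : Type*} [CStarAlgebra B] [CStarAlgebra C]

theorem IsMatrixFiltration.exists_corner {F : ℕ → StarSubalgebra ℂ C} {n N : ℕ}
    (hF : IsMatrixFiltration F fun k => n * N ^ k) (Θ : B →⋆ₙₐ[ℂ] C)
    (hΘ : Function.Injective Θ) (hcorner : ∀ c, ∃ b, Θ b = Θ 1 * c * Θ 1) (j : ℕ)
    (hj : Θ 1 ∈ F j) :
    ∃ (r : ℕ) (G : ℕ → StarSubalgebra ℂ B), IsMatrixFiltration G fun k => r * N ^ k := by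
  have hq : IsStarProjection (Θ 1) :=
    ⟨by rw [IsIdempotentElem, ← map_mul, one_mul], by rw [IsSelfAdjoint, ← map_star, star_one]⟩
  have hql : ∀ b, Θ 1 * Θ b = Θ b := fun b => by rw [← map_mul, one_mul]
  have hqr : ∀ b, Θ b * Θ 1 = Θ b := fun b => by rw [← map_mul, mul_one]
  let e : ∀ k, F k ≃⋆ₐ[ℂ] Matrix (Fin (n * N ^ k)) (Fin (n * N ^ k)) ℂ := fun k =>
    (hF.equiv k).some
  have hjk : ∀ i, Θ 1 ∈ F (j + i) := fun i => hF.mono (Nat.le_add_right j i) hj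
  have hP : ∀ i, IsStarProjection (e (j + i) ⟨Θ 1, hjk i⟩) := fun i =>
    ⟨by rw [IsIdempotentElem, ← map_mul]; exact congrArg _ (Subtype.ext hq.isIdempotentElem),
      by rw [IsSelfAdjoint, ← map_star]; exact congrArg _ (Subtype.ext hq.isSelfAdjoint)⟩
  choose s W hW hW' using fun i => exists_isometry_of_isStarProjection (hP i)
  have hstr : ∀ i, (e (j + i) ⟨Θ 1, hjk i⟩).trace = s i := fun i => by
    rw [← hW', Matrix.trace_mul_comm, hW, Matrix.trace_one, Fintype.card_fin]
  have hs : ∀ i, s i = s 0 * N ^ i := by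
    intro i
    rcases Nat.eq_zero_or_pos (n * N ^ j) with h0 | h0
    · have hz : ∀ l, s l = 0 := fun l => by
        have : IsEmpty (Fin (n * N ^ (j + l))) := by
          rw [pow_add, ← mul_assoc, h0, zero_mul]; infer_instance
        have h := hstr l
        rw [Matrix.trace, Finset.univ_eq_empty, Finset.sum_empty] at h
        exact_mod_cast h.symm
      rw [hz, hz, zero_mul]
    · let ι : F (j + 0) →⋆ₐ[ℂ] F (j + i) :=
        StarSubalgebra.inclusion (hF.mono (Nat.le_add_right j i))
      have h := trace_algHom (((e (j + i)).toAlgEquiv.toAlgHom.comp ι.toAlgHom).comp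
        (e (j + 0)).toAlgEquiv.symm.toAlgHom) (e (j + 0) ⟨Θ 1, hjk 0⟩)
      have h2 : (((e (j + i)).toAlgEquiv.toAlgHom.comp ι.toAlgHom).comp
          (e (j + 0)).toAlgEquiv.symm.toAlgHom) (e (j + 0) ⟨Θ 1, hjk 0⟩)
          = e (j + i) ⟨Θ 1, hjk i⟩ := by
        change e (j + i) (ι ((e (j + 0)).symm (e (j + 0) ⟨Θ 1, hjk 0⟩))) = _
        rw [StarAlgEquiv.symm_apply_apply]
        rfl
      rw [h2, hstr, hstr, Fintype.card_fin, Fintype.card_fin, add_zero, pow_add] at h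
      have h3 : (n * N ^ j) * s i = (n * N ^ j) * (s 0 * N ^ i) := by
        have h' : (n * N ^ j) * s i = n * (N ^ j * N ^ i) * s 0 := by exact_mod_cast h
        rw [h']; ring
      exact Nat.eq_of_mul_eq_mul_left h0 h3
  let G : ℕ → StarSubalgebra ℂ B := fun i =>
    { carrier := {b | Θ b ∈ F (j + i)}
      mul_mem' := fun {a b} ha hb => by
        change Θ (a * b) ∈ F (j + i); rw [map_mul]; exact mul_mem ha hb
      add_mem' := fun {a b} ha hb => by
        change Θ (a + b) ∈ F (j + i); rw [map_add]; exact add_mem ha hb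
      algebraMap_mem' := fun c => by
        change Θ (algebraMap ℂ B c) ∈ F (j + i)
        rw [Algebra.algebraMap_eq_smul_one, map_smul]; exact (F (j + i)).smul_mem (hjk i) c
      star_mem' := fun {a} ha => by
        change Θ (star a) ∈ F (j + i); rw [map_star]; exact star_mem ha }
  refine ⟨s 0, G, ?_, fun i => ?_, fun b ε hε => ?_⟩
  · intro i l hil b hb
    exact hF.mono (Nat.add_le_add_left hil j) hb
  · change Nonempty (G i ≃⋆ₐ[ℂ] Matrix (Fin (s 0 * N ^ i)) (Fin (s 0 * N ^ i)) ℂ)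
    rw [← hs i]
    have hPW : e (j + i) ⟨Θ 1, hjk i⟩ * W i = W i := by
      rw [← hW', Matrix.mul_assoc, hW, Matrix.mul_one]
    have hWP : (W i).conjTranspose * e (j + i) ⟨Θ 1, hjk i⟩ = (W i).conjTranspose := by
      rw [← hW', ← Matrix.mul_assoc, hW, Matrix.one_mul]
    let f : G i →⋆ₐ[ℂ] Matrix (Fin (s i)) (Fin (s i)) ℂ :=
      { toFun := fun b => (W i).conjTranspose * e (j + i) ⟨Θ b, b.2⟩ * W i
        map_one' := by
          change (W i).conjTranspose * e (j + i) ⟨Θ 1, _⟩ * W i = 1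
          rw [hWP, hW]
        map_mul' := fun a b => by
          have h : (⟨Θ ↑(a * b), (a * b).2⟩ : F (j + i))
              = ⟨Θ a, a.2⟩ * ⟨Θ 1, hjk i⟩ * ⟨Θ b, b.2⟩ :=
            Subtype.ext (by
              change Θ (a * b : B) = Θ a * Θ 1 * Θ b
              rw [hqr, map_mul])
          rw [h, map_mul, map_mul, ← hW']
          simp only [Matrix.mul_assoc]
        map_zero' := by
          have h : (⟨Θ ↑(0 : G i), (0 : G i).2⟩ : F (j + i)) = 0 := Subtype.ext (map_zero Θ)
          rw [h, map_zero, Matrix.mul_zero, Matrix.zero_mul]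
        map_add' := fun a b => by
          have h : (⟨Θ ↑(a + b), (a + b).2⟩ : F (j + i)) = ⟨Θ a, a.2⟩ + ⟨Θ b, b.2⟩ :=
            Subtype.ext (map_add Θ _ _)
          rw [h, map_add, Matrix.mul_add, Matrix.add_mul]
        commutes' := fun c => by
          have h : (⟨Θ ↑(algebraMap ℂ (G i) c), (algebraMap ℂ (G i) c).2⟩ : F (j + i))
              = c • ⟨Θ 1, hjk i⟩ :=
            Subtype.ext (by
              change Θ (algebraMap ℂ B c) = c • Θ 1
              rw [Algebra.algebraMap_eq_smul_one, map_smul])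
          rw [h, map_smul, Matrix.mul_smul, Matrix.smul_mul, hWP, hW,
            Algebra.algebraMap_eq_smul_one]
        map_star' := fun a => by
          have h : (⟨Θ ↑(star a), (star a).2⟩ : F (j + i)) = star ⟨Θ a, a.2⟩ :=
            Subtype.ext (map_star Θ _)
          rw [h, map_star, Matrix.star_eq_conjTranspose, Matrix.star_eq_conjTranspose]
          simp only [Matrix.conjTranspose_mul, Matrix.conjTranspose_conjTranspose,
            Matrix.mul_assoc] }
    refine ⟨StarAlgEquiv.ofBijective f ⟨?_, fun X => ?_⟩⟩
    · rw [injective_iff_map_eq_zero]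
      intro b hb
      have h1 : e (j + i) ⟨Θ b, b.2⟩ = 0 := by
        have h : (⟨Θ b, b.2⟩ : F (j + i)) = ⟨Θ 1, hjk i⟩ * ⟨Θ b, b.2⟩ * ⟨Θ 1, hjk i⟩ :=
          Subtype.ext (by
            change Θ b = Θ 1 * Θ b * Θ 1
            rw [hql, hqr])
        rw [h, map_mul, map_mul, ← hW']
        calc _ = W i * ((W i).conjTranspose * e (j + i) ⟨Θ b, b.2⟩ * W i)
              * (W i).conjTranspose := by
              simp only [Matrix.mul_assoc]
          _ = W i * f b * (W i).conjTranspose := rfl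
          _ = 0 := by rw [hb, Matrix.mul_zero, Matrix.zero_mul]
      have h2 : Θ b = 0 := congrArg Subtype.val ((map_eq_zero_iff _ (e (j + i)).injective).1 h1)
      exact Subtype.ext ((map_eq_zero_iff Θ hΘ).1 h2)
    · let c := (e (j + i)).symm (W i * X * (W i).conjTranspose)
      obtain ⟨b, hb⟩ := hcorner c
      have hc : (⟨Θ 1, hjk i⟩ * c * ⟨Θ 1, hjk i⟩ : F (j + i)) = c := by
        refine EquivLike.injective (e (j + i)) ?_
        rw [map_mul, map_mul, StarAlgEquiv.apply_symm_apply, Matrix.mul_assoc,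
          Matrix.mul_assoc (W i * X), hWP, ← Matrix.mul_assoc, ← Matrix.mul_assoc, hPW]
      have hb' : Θ b = c := hb.trans (congrArg Subtype.val hc)
      have hbm : Θ b ∈ F (j + i) := hb' ▸ c.2
      refine ⟨⟨b, hbm⟩, ?_⟩
      change (W i).conjTranspose * e (j + i) ⟨Θ b, hbm⟩ * W i = X
      have h : (⟨Θ b, hbm⟩ : F (j + i)) = c := Subtype.ext hb'
      rw [h, StarAlgEquiv.apply_symm_apply]
      calc _ = ((W i).conjTranspose * W i) * X * ((W i).conjTranspose * W i) := by
            simp only [Matrix.mul_assoc]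
        _ = X := by rw [hW, Matrix.one_mul, Matrix.mul_one]
  · obtain ⟨k, x, hx, hxb⟩ := hF.dense (Θ b) ε hε
    obtain ⟨b', hb'⟩ := hcorner x
    refine ⟨k, b', ?_, ?_⟩
    · change Θ b' ∈ F (j + k)
      rw [hb']
      exact mul_mem (mul_mem (hjk k) (hF.mono (Nat.le_add_left k j) hx)) (hjk k)
    · rw [← NonUnitalStarAlgHom.norm_map Θ hΘ, map_sub, hb']
      have h : Θ b - Θ 1 * x * Θ 1 = Θ 1 * (Θ b - x) * Θ 1 := by
        rw [mul_sub, sub_mul, hql, hqr]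
      rw [h]
      have hq1 : ‖Θ 1‖ ≤ 1 := hq.norm_le
      calc ‖Θ 1 * (Θ b - x) * Θ 1‖ ≤ ‖Θ 1‖ * ‖Θ b - x‖ * ‖Θ 1‖ := norm_mul₃_le
        _ ≤ 1 * ‖Θ b - x‖ * 1 := by gcongr
        _ < ε := by rwa [one_mul, mul_one]

end Corners

section Amplification
variable {A : Type*} [CStarAlgebra A] [PartialOrder A] [StarOrderedRing A]

/-- The matrices with entries in a star subalgebra. -/
def entrywise (n : ℕ) (S : StarSubalgebra ℂ A) :
    StarSubalgebra ℂ (CStarMatrix (Fin n) (Fin n) A) where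
  carrier := {M | ∀ i j, M i j ∈ S}
  mul_mem' := fun {M M'} h h' i j => by
    rw [CStarMatrix.mul_apply]
    exact sum_mem fun l _ => mul_mem (h i l) (h' l j)
  add_mem' := fun h h' i j => add_mem (h i j) (h' i j)
  algebraMap_mem' := fun c i j => by
    rw [CStarMatrix.algebraMap_apply]
    split_ifs
    · exact algebraMap_mem S c
    · exact zero_mem S
  star_mem' := fun h i j => star_mem (h j i)

/-- Matrices over a full matrix algebra form a full matrix algebra. -/
theorem nonempty_entrywise_equiv (n d : ℕ) {S : StarSubalgebra ℂ A}
    (e : S ≃⋆ₐ[ℂ] Matrix (Fin d) (Fin d) ℂ) :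
    Nonempty (entrywise n S ≃⋆ₐ[ℂ] Matrix (Fin (n * d)) (Fin (n * d)) ℂ) := by
  let g : Fin (n * d) ≃ Fin n × Fin d := finProdFinEquiv.symm
  have halg : ∀ (c : ℂ) (x y : Fin (n * d)),
      e ⟨(algebraMap ℂ (entrywise n S) c).1 (g x).1 (g y).1,
        (algebraMap ℂ (entrywise n S) c).2 _ _⟩
        (g x).2 (g y).2 = algebraMap ℂ (Matrix (Fin (n * d)) (Fin (n * d)) ℂ) c x y := by
    intro c x y
    have h : (⟨(algebraMap ℂ (entrywise n S) c).1 (g x).1 (g y).1,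
        (algebraMap ℂ (entrywise n S) c).2 _ _⟩ : S)
        = if (g x).1 = (g y).1 then c • 1 else 0 := by
      refine Subtype.ext ?_
      change (algebraMap ℂ (CStarMatrix (Fin n) (Fin n) A) c) (g x).1 (g y).1 = _
      rw [CStarMatrix.algebraMap_apply, Algebra.algebraMap_eq_smul_one]
      split_ifs <;> rfl
    rw [h, Matrix.algebraMap_matrix_apply]
    by_cases hxy : x = y
    · subst hxy
      simp
    · rw [if_neg hxy]
      split_ifs with h1
      · rw [map_smul, map_one, Matrix.smul_apply, Matrix.one_apply_ne, smul_zero]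
        exact fun h2 => hxy (g.injective (Prod.ext h1 h2))
      · rw [map_zero, Matrix.zero_apply]
  let f : entrywise n S →⋆ₐ[ℂ] Matrix (Fin (n * d)) (Fin (n * d)) ℂ :=
    { toFun := fun M => Matrix.of fun x y =>
        e ⟨M.1 (g x).1 (g y).1, M.2 _ _⟩ (g x).2 (g y).2
      map_one' := by
        ext x y
        simpa only [map_one, Matrix.of_apply] using halg 1 x y
      map_mul' := fun M M' => by
        ext x y
        have h : (⟨(M * M').1 (g x).1 (g y).1, (M * M').2 _ _⟩ : S)
            = ∑ l, ⟨M.1 (g x).1 l, M.2 _ _⟩ * ⟨M'.1 l (g y).1, M'.2 _ _⟩ :=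
          Subtype.ext (by simp [CStarMatrix.mul_apply])
        rw [Matrix.of_apply, h, map_sum, Matrix.sum_apply, Matrix.mul_apply,
          ← g.symm.sum_comp, Fintype.sum_prod_type]
        refine Finset.sum_congr rfl fun l _ => ?_
        rw [map_mul, Matrix.mul_apply]
        simp
      map_zero' := by
        ext x y
        simpa only [map_zero, Matrix.of_apply] using halg 0 x y
      map_add' := fun M M' => by
        ext x y
        have h : (⟨(M + M').1 (g x).1 (g y).1, (M + M').2 _ _⟩ : S)
            = ⟨M.1 (g x).1 (g y).1, M.2 _ _⟩ + ⟨M'.1 (g x).1 (g y).1, M'.2 _ _⟩ := rfl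
        rw [Matrix.of_apply, h, map_add, Matrix.add_apply, Matrix.add_apply, Matrix.of_apply,
          Matrix.of_apply]
      commutes' := fun c => by
        ext x y
        exact halg c x y
      map_star' := fun M => by
        ext x y
        have h : (⟨(star M).1 (g x).1 (g y).1, (star M).2 _ _⟩ : S)
            = star ⟨M.1 (g y).1 (g x).1, M.2 _ _⟩ := rfl
        rw [Matrix.of_apply, h, map_star, Matrix.star_apply, Matrix.star_apply, Matrix.of_apply] }
  refine ⟨StarAlgEquiv.ofBijective f ⟨?_, fun X => ?_⟩⟩
  · intro M M' h
    refine Subtype.ext (CStarMatrix.ext fun i j => ?_)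
    have h1 : (⟨M.1 i j, M.2 i j⟩ : S) = ⟨M'.1 i j, M'.2 i j⟩ := by
      refine EquivLike.injective e (Matrix.ext fun a b => ?_)
      have h2 := congrFun (congrFun h (g.symm (i, a))) (g.symm (j, b))
      simpa [f] using h2
    exact congrArg Subtype.val h1
  · let Y : Fin n → Fin n → S := fun i j =>
      e.symm (Matrix.of fun a b => X (g.symm (i, a)) (g.symm (j, b)))
    refine ⟨⟨CStarMatrix.ofMatrix (Matrix.of fun i j => (Y i j : A)), fun i j => (Y i j).2⟩, ?_⟩
    ext x y
    change e (Y (g x).1 (g y).1) (g x).2 (g y).2 = X x y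
    simp [Y]

theorem IsMatrixFiltration.entrywise {F : ℕ → StarSubalgebra ℂ A} {d : ℕ → ℕ}
    (hF : IsMatrixFiltration F d) (n : ℕ) :
    IsMatrixFiltration (fun k => entrywise n (F k)) fun k => n * d k where
  mono := fun _ _ hkl _ hM i j => hF.mono hkl (hM i j)
  equiv := fun k => nonempty_entrywise_equiv n (d k) (hF.equiv k).some
  dense := fun M ε hε => by
    have hcont : Continuous fun f : Fin n → Fin n → A =>
        ‖M - CStarMatrix.ofMatrix (Matrix.of f)‖ :=
      continuous_norm.comp (continuous_const.sub continuous_id)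
    have hmem : ∀ᶠ f in 𝓝 (fun i j => M i j), ‖M - CStarMatrix.ofMatrix (Matrix.of f)‖ < ε := by
      refine hcont.continuousAt.eventually_lt continuousAt_const ?_
      have : M - CStarMatrix.ofMatrix (Matrix.of fun i j => M i j) = 0 := sub_self M
      rwa [this, norm_zero]
    obtain ⟨δ, hδ, hball⟩ := Metric.eventually_nhds_iff.1 hmem
    choose k x hx hxM using fun i j => hF.dense (M i j) δ hδ
    let K := Finset.univ.sup fun i => Finset.univ.sup fun j => k i j
    have hK : ∀ i j, k i j ≤ K := fun i j =>
      (Finset.le_sup (f := fun j => k i j) (Finset.mem_univ j)).trans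
        (Finset.le_sup (f := fun i => Finset.univ.sup fun j => k i j) (Finset.mem_univ i))
    refine ⟨K, CStarMatrix.ofMatrix (Matrix.of x), fun i j => hF.mono (hK i j) (hx i j),
      hball ?_⟩
    refine (dist_pi_lt_iff hδ).2 fun i => (dist_pi_lt_iff hδ).2 fun j => ?_
    rw [dist_comm, dist_eq_norm]
    exact hxM i j

end Amplification

/-! ### The corner embedding defined by an equivalence bimodule -/

section Morita
variable {A B X : Type u} [CStarAlgebra A] [CStarAlgebra B] [AddCommGroup X] [Module ℂ X]

namespace Bimod
variable (bm : Bimod A B X) {ι : Type*}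

theorem rs_sum (x : X) (s : Finset ι) (f : ι → B) :
    bm.rs x (∑ i ∈ s, f i) = ∑ i ∈ s, bm.rs x (f i) :=
  map_sum (AddMonoidHom.mk' (bm.rs x) (bm.rs_add x)) f s

theorem linn_sum_left (s : Finset ι) (f : ι → X) (y : X) :
    bm.linn (∑ i ∈ s, f i) y = ∑ i ∈ s, bm.linn (f i) y :=
  map_sum (AddMonoidHom.mk' (fun x => bm.linn x y) fun x z => bm.linn_add_left x z y) f s

theorem rinn_sum_right (x : X) (s : Finset ι) (f : ι → X) :
    bm.rinn x (∑ i ∈ s, f i) = ∑ i ∈ s, bm.rinn x (f i) :=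
  map_sum (AddMonoidHom.mk' (bm.rinn x) (bm.rinn_add_right x)) f s

theorem rinn_rs_left (x y : X) (b : B) : bm.rinn (bm.rs x b) y = star b * bm.rinn x y := by
  rw [← bm.rinn_star, bm.rinn_rs, star_mul, bm.rinn_star]

theorem rinn_sub_self (x y : X) :
    bm.rinn (x - y) (x - y)
      = bm.rinn x x + bm.rinn y y - (bm.rinn x y + star (bm.rinn x y)) := by
  have h1 : x - y = x + (-1 : ℂ) • y := by rw [neg_one_smul, sub_eq_add_neg]
  rw [h1, bm.rinn_add_left, bm.rinn_add_right, bm.rinn_add_right, bm.rinn_star]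
  simp only [bm.rinn_smul_left, bm.rinn_smul_right]
  simp only [map_neg, map_one, neg_smul, one_smul]
  abel

variable {bm}

/-- Fullness of the right inner product gives a finite family that is normalized for it. -/
theorem exists_sum_rinn_eq_one_s19
    (hfull : Submodule.span ℂ (Set.range fun p : X × X => bm.rinn p.1 p.2) = ⊤) :
    ∃ (n : ℕ) (x : Fin n → X), ∑ i, bm.rinn (x i) (x i) = 1 := by
  let _ : PartialOrder B := CStarAlgebra.spectralOrder B
  have _ : StarOrderedRing B := CStarAlgebra.spectralOrderedRing B
  have hpos : ∀ x, 0 ≤ bm.rinn x x := fun x => by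
    obtain ⟨b, hb⟩ := bm.rinn_pos x
    rw [hb]
    exact star_mul_self_nonneg b
  have hdom : ∀ b ∈ Submodule.span ℂ (Set.range fun p : X × X => bm.rinn p.1 p.2),
      ∀ c : ℂ, ∃ s ∈ AddSubmonoid.closure (Set.range fun x => bm.rinn x x),
        c • b + star (c • b) ≤ s := by
    intro b hb
    induction hb using Submodule.span_induction with
    | mem b hb =>
      obtain ⟨⟨x, y⟩, rfl⟩ := hb
      intro c
      refine ⟨bm.rinn x x + bm.rinn (c • y) (c • y),
        add_mem (AddSubmonoid.subset_closure ⟨x, rfl⟩)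
          (AddSubmonoid.subset_closure ⟨c • y, rfl⟩), ?_⟩
      have h := hpos (x - c • y)
      rwa [rinn_sub_self, sub_nonneg, bm.rinn_smul_right] at h
    | zero => exact fun c => ⟨0, zero_mem _, by simp⟩
    | add a b _ _ ha hb =>
      intro c
      obtain ⟨s, hs, hs'⟩ := ha c
      obtain ⟨t, ht, ht'⟩ := hb c
      refine ⟨s + t, add_mem hs ht, le_trans (le_of_eq ?_) (add_le_add hs' ht')⟩
      rw [smul_add, star_add]
      abel
    | smul d b _ hb =>
      intro c
      obtain ⟨s, hs, hs'⟩ := hb (c * d)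
      exact ⟨s, hs, by rwa [smul_smul]⟩
  obtain ⟨t, ht, ht1⟩ := hdom 1 (hfull ▸ Submodule.mem_top) (1 / 2)
  have ht1 : 1 ≤ t := by
    refine le_trans (le_of_eq ?_) ht1
    rw [star_smul, star_one, ← add_smul]
    norm_num
  have htpos : IsStrictlyPositive t :=
    IsStrictlyPositive.of_le isStrictlyPositive_one ht1
  obtain ⟨l, hl, hlt⟩ := AddSubmonoid.exists_list_of_mem_closure ht
  choose y hy using hl
  let w := t ^ (-(1 / 2) : ℝ)
  have hw : star w = w := (CFC.rpow_nonneg).isSelfAdjoint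
  refine ⟨l.length, fun i => bm.rs (y l[i] (List.getElem_mem _)) w, ?_⟩
  have h : ∀ i : Fin l.length, bm.rinn (bm.rs (y l[i] (List.getElem_mem _)) w)
      (bm.rs (y l[i] (List.getElem_mem _)) w) = w * l[i] * w := fun i => by
    rw [bm.rinn_rs, rinn_rs_left, hw]
    exact congrArg (w * · * w) (hy _ _)
  rw [Finset.sum_congr rfl fun i _ => h i, ← Finset.sum_mul, ← Finset.mul_sum]
  have hsum : ∑ i : Fin l.length, l[i] = t := (Fin.sum_univ_getElem l).trans hlt
  rw [hsum]
  exact CFC.conjugate_rpow_neg_one_half t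

variable [PartialOrder A] [StarOrderedRing A]

/-- The Gram-matrix embedding of `B` in a matrix algebra over `A` attached to a normalized
finite family in an equivalence bimodule. -/
def gramHom (hbm : bm.IsEquivalence) {n : ℕ} (x : Fin n → X)
    (hx : ∑ i, bm.rinn (x i) (x i) = 1) : B →⋆ₙₐ[ℂ] CStarMatrix (Fin n) (Fin n) A where
  toFun b := CStarMatrix.ofMatrix (Matrix.of fun i j => bm.linn (bm.rs (x i) b) (x j))
  map_smul' c b := by
    ext i j
    change bm.linn (bm.rs (x i) (c • b)) (x j) = c • bm.linn (bm.rs (x i) b) (x j)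
    rw [bm.rs_smul, bm.linn_smul_left]
  map_zero' := by
    ext i j
    change bm.linn (bm.rs (x i) 0) (x j) = 0
    rw [← zero_smul ℂ (0 : B), bm.rs_smul, bm.linn_smul_left, zero_smul]
  map_add' b c := by
    ext i j
    change bm.linn (bm.rs (x i) (b + c)) (x j)
      = bm.linn (bm.rs (x i) b) (x j) + bm.linn (bm.rs (x i) c) (x j)
    rw [bm.rs_add, bm.linn_add_left]
  map_mul' b c := by
    ext i j
    rw [CStarMatrix.mul_apply]
    change bm.linn (bm.rs (x i) (b * c)) (x j)
      = ∑ k, bm.linn (bm.rs (x i) b) (x k) * bm.linn (bm.rs (x k) c) (x j)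
    have h : ∀ k, bm.linn (bm.rs (x i) b) (x k) * bm.linn (bm.rs (x k) c) (x j)
        = bm.linn (bm.rs (bm.rs (x i) b) (bm.rinn (x k) (x k) * c)) (x j) := fun k => by
      rw [← bm.linn_ls, hbm.1, bm.rinn_rs]
    rw [Finset.sum_congr rfl fun k _ => h k, ← bm.linn_sum_left, ← bm.rs_sum, ← Finset.sum_mul,
      hx, one_mul, bm.rs_mul]
  map_star' b := by
    ext i j
    change bm.linn (bm.rs (x i) (star b)) (x j) = star (bm.linn (bm.rs (x j) b) (x i))
    rw [bm.linn_star, bm.linn_rs, star_star]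

variable {hbm : bm.IsEquivalence} {n : ℕ} {x : Fin n → X} {hx : ∑ i, bm.rinn (x i) (x i) = 1}

theorem gramHom_apply (b : B) (i j : Fin n) :
    bm.gramHom hbm x hx b i j = bm.linn (bm.rs (x i) b) (x j) := rfl

theorem gramHom_injective : Function.Injective (bm.gramHom hbm x hx) := by
  have h : ∀ b, ∑ i, ∑ j, bm.rinn (x i) (bm.ls (bm.gramHom hbm x hx b i j) (x j)) = b := by
    intro b
    simp only [gramHom_apply, hbm.1]
    simp only [← bm.rinn_sum_right, ← bm.rs_sum, hx, bm.rs_one]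
    simp only [bm.rinn_rs]
    rw [← Finset.sum_mul, hx, one_mul]
  intro b c hbc
  rw [← h b, hbc, h c]

theorem exists_gramHom_eq (M : CStarMatrix (Fin n) (Fin n) A) :
    ∃ b, bm.gramHom hbm x hx b = bm.gramHom hbm x hx 1 * M * bm.gramHom hbm x hx 1 := by
  refine ⟨∑ l, ∑ k, bm.rinn (x k) (bm.ls (M k l) (x l)), ?_⟩
  ext i j
  simp only [CStarMatrix.mul_apply, gramHom_apply, bm.rs_one, bm.rs_sum,
    bm.linn_sum_left, Finset.sum_mul, ← hbm.1, bm.linn_ls, mul_assoc]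

end Bimod

end Morita

/-! ### Unital algebras Morita equivalent to a UHF algebra -/

section UHF
variable {A B X : Type u} [CStarAlgebra A] [CStarAlgebra B] [AddCommGroup X] [Module ℂ X]

theorem isMatrixFiltration_of_topologicalClosure_eq_top {F : ℕ → StarSubalgebra ℂ A} {d : ℕ → ℕ}
    (hmono : Monotone F)
    (hequiv : ∀ k, Nonempty (F k ≃⋆ₐ[ℂ] Matrix (Fin (d k)) (Fin (d k)) ℂ))
    (hdense : (⨆ k, F k).topologicalClosure = ⊤) : IsMatrixFiltration F d where
  mono := hmono
  equiv := hequiv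
  dense := fun c ε hε => by
    have hc : c ∈ (⨆ k, F k).topologicalClosure := hdense ▸ StarSubalgebra.mem_top
    obtain ⟨x, hx, hcx⟩ := Metric.mem_closure_iff.1 hc ε hε
    have hx' : x ∈ ⨆ k, F k := hx
    rw [← SetLike.mem_coe, StarSubalgebra.coe_iSup_of_directed hmono.directed_le] at hx'
    obtain ⟨k, hk⟩ := Set.mem_iUnion.1 hx'
    exact ⟨k, x, hk, by rwa [← dist_eq_norm]⟩

theorem Bimod.IsEquivalence.exists_matrix_starAlgEquiv [PartialOrder A] [StarOrderedRing A]
    {bm : Bimod A B X} (hbm : bm.IsEquivalence) {F : ℕ → StarSubalgebra ℂ A} {N : ℕ}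
    (hF : IsMatrixFiltration F fun k => N ^ k) :
    ∃ r, Nonempty (CStarMatrix (Fin r) (Fin r) A ≃⋆ₐ[ℂ] B) := by
  obtain ⟨n, x, hx⟩ := exists_sum_rinn_eq_one_s19 hbm.2.2
  let Φ := bm.gramHom hbm x hx
  have hp : IsStarProjection (Φ 1) :=
    ⟨by rw [IsIdempotentElem, ← map_mul, one_mul], by rw [IsSelfAdjoint, ← map_star, star_one]⟩
  have hFn := hF.entrywise n
  obtain ⟨j, y, hy, hpy⟩ := hFn.dense (Φ 1) (1 / 32) (by norm_num)
  obtain ⟨q, hqF, hq, hpq⟩ := exists_isStarProjection_mem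
    (isClosed_of_equiv_matrix (hFn.equiv j).some) hp hy hpy
  obtain ⟨u, hu, hup⟩ := exists_unitary_of_norm_sub_lt_one hp hq hpq
  let c := Unitary.conjStarAlgAut ℂ (CStarMatrix (Fin n) (Fin n) A) ⟨u, hu⟩
  have hc : ∀ z, c z = u * z * star u := fun z => rfl
  let Θ : B →⋆ₙₐ[ℂ] CStarMatrix (Fin n) (Fin n) A := (c : _ →⋆ₙₐ[ℂ] _).comp Φ
  have hΘ : ∀ b, Θ b = c (Φ b) := fun _ => rfl
  have hΘ1 : Θ 1 = q := by
    rw [hΘ, hc, hup, mul_assoc, Unitary.mul_star_self_of_mem hu, mul_one]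
  obtain ⟨r, G, hG⟩ := hFn.exists_corner Θ
    ((EquivLike.injective c).comp (Bimod.gramHom_injective (hbm := hbm) (hx := hx)))
    (fun z => by
      obtain ⟨b, hb⟩ := Bimod.exists_gramHom_eq (hbm := hbm) (hx := hx) (c.symm z)
      refine ⟨b, ?_⟩
      rw [hΘ, hΘ, congrArg c hb, map_mul, map_mul, StarAlgEquiv.apply_symm_apply]) j (hΘ1 ▸ hqF)
  exact ⟨r, (hF.entrywise r).nonempty_starAlgEquiv hG⟩

end UHF

/-! ### Amplification of coactions to matrix algebras -/

section TensorMaps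
variable {M P C : Type*} [AddCommGroup M] [Module ℂ M] [AddCommGroup P] [Module ℂ P]

theorem appRight_map [AddCommGroup C] [Module ℂ C] (f : C →ₗ[ℂ] ℂ) (g : M →ₗ[ℂ] P)
    (t : M ⊗[ℂ] C) :
    appRight f (TensorProduct.map g LinearMap.id t) = g (appRight f t) := by
  induction t with
  | zero => simp only [map_zero]
  | tmul m c => simp [appRight]
  | add s t hs ht => simp only [map_add, hs, ht]

theorem map_map_assoc_symm {C D : Type*} [AddCommGroup C] [Module ℂ C] [AddCommGroup D]
    [Module ℂ D] (g : M →ₗ[ℂ] P) (t : M ⊗[ℂ] (C ⊗[ℂ] D)) :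
    TensorProduct.map (TensorProduct.map g LinearMap.id) LinearMap.id
        ((TensorProduct.assoc ℂ M C D).symm t)
      = (TensorProduct.assoc ℂ P C D).symm (TensorProduct.map g LinearMap.id t) := by
  induction t with
  | zero => simp only [map_zero]
  | add s t hs ht => simp only [map_add, hs, ht]
  | tmul m u =>
    induction u with
    | zero => simp only [TensorProduct.tmul_zero, map_zero]
    | add s t hs ht => simp only [TensorProduct.tmul_add, map_add, hs, ht]
    | tmul c d => simp

variable [Ring C] [Algebra ℂ C] [StarRing C] [FiniteDimensional ℂ C]

theorem tstarWith_map {sM : M → M} {sP : P → P} {g g' : M →ₗ[ℂ] P}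
    (h : ∀ m, sP (g m) = g' (sM m)) (t : M ⊗[ℂ] C) :
    tstarWith sP (TensorProduct.map g LinearMap.id t)
      = TensorProduct.map g' LinearMap.id (tstarWith sM t) := by
  simp only [tstarWith, tcoord, appRight_map, h, map_sum, TensorProduct.map_tmul,
    LinearMap.id_apply]

theorem tstarWith_sum {ι : Type*} {sM : M → M} (h : ∀ m n, sM (m + n) = sM m + sM n)
    (s : Finset ι) (f : ι → M ⊗[ℂ] C) :
    tstarWith sM (∑ i ∈ s, f i) = ∑ i ∈ s, tstarWith sM (f i) :=
  map_sum (AddMonoidHom.mk' (tstarWith sM) fun a b => by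
    simp only [tstarWith, map_add, h, TensorProduct.add_tmul, Finset.sum_add_distrib]) f s

end TensorMaps

section MatrixCoaction
variable {A B : Type u} [CStarAlgebra A] [PartialOrder A] [StarOrderedRing A] [CStarAlgebra B]
  {r : ℕ}

/-- The embedding of `A` in `B ≅ M_r(A)` as the matrices supported at the entry `(i, k)`. -/
def entryIncl (θ : CStarMatrix (Fin r) (Fin r) A ≃⋆ₐ[ℂ] B) (i k : Fin r) : A →ₗ[ℂ] B where
  toFun a := θ (CStarMatrix.ofMatrix (Matrix.single i k a))
  map_add' a b := by
    rw [Matrix.single_add, ← map_add]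
    rfl
  map_smul' c a := by
    rw [RingHom.id_apply, ← map_smul, ← Matrix.smul_single]
    rfl

/-- The `(i, k)` entry of an element of `B ≅ M_r(A)`. -/
def entryCoord (θ : CStarMatrix (Fin r) (Fin r) A ≃⋆ₐ[ℂ] B) (i k : Fin r) : B →ₗ[ℂ] A where
  toFun b := θ.symm b i k
  map_add' a b := by rw [map_add]; rfl
  map_smul' c a := by rw [map_smul]; rfl

variable (θ : CStarMatrix (Fin r) (Fin r) A ≃⋆ₐ[ℂ] B)

theorem entryIncl_mul_entryIncl (i k j l : Fin r) (a b : A) :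
    entryIncl θ i k a * entryIncl θ j l b = if k = j then entryIncl θ i l (a * b) else 0 := by
  change θ _ * θ _ = _
  rw [← map_mul]
  split_ifs with h
  · subst h
    exact congrArg θ (Matrix.single_mul_single_same a i k l b)
  · exact (congrArg θ (Matrix.single_mul_single_of_ne a i k j h b)).trans (map_zero θ)

theorem star_entryIncl (i k : Fin r) (a : A) :
    star (entryIncl θ i k a) = entryIncl θ k i (star a) := by
  change star (θ _) = θ _
  rw [← map_star]
  exact congrArg θ (Matrix.conjTranspose_single i k a)

theorem entryCoord_entryIncl (i k j l : Fin r) (a : A) :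
    entryCoord θ i k (entryIncl θ j l a) = if j = i ∧ l = k then a else 0 := by
  change θ.symm (θ _) i k = _
  rw [StarAlgEquiv.symm_apply_apply]
  rfl

theorem sum_entryIncl_entryCoord (b : B) :
    ∑ i, ∑ k, entryIncl θ i k (entryCoord θ i k b) = b := by
  change ∑ i, ∑ k, θ _ = b
  simp only [← map_sum]
  refine (congrArg θ ?_).trans (θ.apply_symm_apply b)
  exact (Matrix.matrix_eq_sum_single (CStarMatrix.ofMatrix.symm (θ.symm b))).symm

theorem entryCoord_one (i k : Fin r) : entryCoord θ i k 1 = if i = k then 1 else 0 := by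
  change θ.symm 1 i k = _
  rw [map_one]
  rfl

theorem entryCoord_mul (i k : Fin r) (b c : B) :
    entryCoord θ i k (b * c) = ∑ l, entryCoord θ i l b * entryCoord θ l k c := by
  change θ.symm (b * c) i k = _
  rw [map_mul, CStarMatrix.mul_apply]
  rfl

theorem entryCoord_star (i k : Fin r) (b : B) :
    entryCoord θ i k (star b) = star (entryCoord θ k i b) := by
  change θ.symm (star b) i k = _
  rw [map_star]
  rfl

theorem continuous_entryIncl (i k : Fin r) : Continuous (entryIncl θ i k) := by
  have hθ : Continuous θ := (NonUnitalStarAlgHom.isometry θ (EquivLike.injective θ)).continuous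
  refine hθ.comp (?_ : Continuous fun a => CStarMatrix.ofMatrix (Matrix.single i k a))
  refine continuous_pi fun j => continuous_pi fun l => ?_
  change Continuous fun a => if i = j ∧ k = l then a else 0
  split_ifs
  · exact continuous_id
  · exact continuous_const

/-- The diagonal embedding of `A` in `B ≅ M_r(A)`. -/
def diagIncl : A →⋆ₐ[ℂ] B :=
  have hone : ∑ i, entryIncl θ i i 1 = 1 := by
    conv_rhs => rw [← sum_entryIncl_entryCoord θ 1]
    simp [entryCoord_one, apply_ite]
  { toFun := fun a => ∑ i, entryIncl θ i i a
    map_one' := hone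
    map_mul' := fun a b => by
      simp [Finset.sum_mul_sum, entryIncl_mul_entryIncl]
    map_zero' := by simp
    map_add' := fun a b => by simp [Finset.sum_add_distrib]
    commutes' := fun c => by
      simp only [Algebra.algebraMap_eq_smul_one, map_smul, ← Finset.smul_sum, hone]
    map_star' := fun a => by simp [star_sum, star_entryIncl] }

theorem diagIncl_apply (a : A) : diagIncl θ a = ∑ i, entryIncl θ i i a := rfl

theorem diagIncl_mul_entryIncl (i k : Fin r) (a b : A) :
    diagIncl θ a * entryIncl θ i k b = entryIncl θ i k (a * b) := by
  simp [diagIncl_apply, Finset.sum_mul, entryIncl_mul_entryIncl]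

theorem entryIncl_mul_diagIncl (i k : Fin r) (a b : A) :
    entryIncl θ i k b * diagIncl θ a = entryIncl θ i k (b * a) := by
  simp [diagIncl_apply, Finset.mul_sum, entryIncl_mul_entryIncl]

theorem continuous_diagIncl : Continuous (diagIncl θ) :=
  continuous_finsetSum Finset.univ fun i _ => continuous_entryIncl θ i i

theorem diagIncl_commutator (a : A) (b : B) :
    diagIncl θ a * b - b * diagIncl θ a
      = ∑ i, ∑ k, entryIncl θ i k (a * entryCoord θ i k b - entryCoord θ i k b * a) := by
  conv_lhs => rw [← sum_entryIncl_entryCoord θ b]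
  simp only [Finset.mul_sum, Finset.sum_mul, diagIncl_mul_entryIncl, entryIncl_mul_diagIncl,
    ← Finset.sum_sub_distrib, map_sub]

variable {H0 : Type u} [Ring H0] [Algebra ℂ H0]

/-- The entrywise coaction on `B ≅ M_r(A)` induced by a coaction on `A`. -/
def matrixCoaction (ρ : A →ₗ[ℂ] A ⊗[ℂ] H0) : B →ₗ[ℂ] B ⊗[ℂ] H0 :=
  ∑ i, ∑ k, TensorProduct.map (entryIncl θ i k) LinearMap.id ∘ₗ ρ ∘ₗ entryCoord θ i k

variable {ρ : A →ₗ[ℂ] A ⊗[ℂ] H0}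

theorem matrixCoaction_apply (b : B) :
    matrixCoaction θ ρ b = ∑ i, ∑ k,
      TensorProduct.map (entryIncl θ i k) LinearMap.id (ρ (entryCoord θ i k b)) := by
  simp [matrixCoaction, LinearMap.sum_apply]

theorem matrixCoaction_entryIncl (i k : Fin r) (a : A) :
    matrixCoaction θ ρ (entryIncl θ i k a)
      = TensorProduct.map (entryIncl θ i k) LinearMap.id (ρ a) := by
  simp [matrixCoaction_apply, entryCoord_entryIncl, apply_ite, ite_and]

theorem map_entryIncl_mul_map_entryIncl (i k j l : Fin r) (s t : A ⊗[ℂ] H0) :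
    TensorProduct.map (entryIncl θ i k) LinearMap.id s
        * TensorProduct.map (entryIncl θ j l) LinearMap.id t
      = if k = j then TensorProduct.map (entryIncl θ i l) LinearMap.id (s * t) else 0 := by
  induction s with
  | zero => simp
  | add s s' hs hs' =>
    rw [map_add, add_mul, hs, hs', add_mul, map_add]
    split_ifs <;> simp
  | tmul a c =>
    induction t with
    | zero => simp
    | add t t' ht ht' =>
      rw [map_add, mul_add, ht, ht', mul_add, map_add]
      split_ifs <;> simp
    | tmul b d =>
      simp only [TensorProduct.map_tmul, Algebra.TensorProduct.tmul_mul_tmul,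
        entryIncl_mul_entryIncl, LinearMap.id_apply]
      split_ifs <;> simp

variable [StarRing H0] [StarModule ℂ H0] [FiniteDimensional ℂ H0]

theorem IsCoaction.matrixCoaction {Δ0 : H0 →ₗ[ℂ] H0 ⊗[ℂ] H0} {ε0 : H0 →ₗ[ℂ] ℂ}
    (hρ : IsCoaction Δ0 ε0 ρ) : IsCoaction Δ0 ε0 (matrixCoaction θ ρ) where
  map_one := by
    have h : ∀ i, TensorProduct.map (entryIncl θ i i) LinearMap.id (1 : A ⊗[ℂ] H0)
        = entryIncl θ i i 1 ⊗ₜ 1 := fun i => TensorProduct.map_tmul _ _ _ _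
    simp only [matrixCoaction_apply, entryCoord_one, apply_ite ρ, apply_ite (TensorProduct.map _ _),
      map_zero, Finset.sum_ite_eq, Finset.mem_univ, if_true, hρ.map_one, h]
    rw [← TensorProduct.sum_tmul, ← diagIncl_apply, map_one]
    rfl
  map_mul b c := by
    simp only [matrixCoaction_apply, entryCoord_mul, map_sum, hρ.map_mul, Finset.sum_mul_sum,
      map_entryIncl_mul_map_entryIncl]
    refine Finset.sum_congr rfl fun i _ => ?_
    rw [Finset.sum_comm]
    conv_rhs => rw [Finset.sum_comm]
    refine Finset.sum_congr rfl fun l _ => ?_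
    conv_rhs => rw [Finset.sum_comm]
    simp
  map_star b := by
    simp only [matrixCoaction_apply, entryCoord_star, hρ.map_star,
      tstarWith_sum (sM := (star : B → B)) star_add]
    rw [Finset.sum_comm]
    refine Finset.sum_congr rfl fun i _ => Finset.sum_congr rfl fun k _ => ?_
    rw [tstarWith_map fun a => star_entryIncl θ i k a]
  counital b := by
    simp only [matrixCoaction_apply, map_sum, appRight_map, hρ.counital, sum_entryIncl_entryCoord]
  coassoc b := by
    simp only [matrixCoaction_apply θ b, map_sum]
    refine Finset.sum_congr rfl fun i _ => Finset.sum_congr rfl fun k _ => ?_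
    have h : SMEPaper.matrixCoaction θ ρ ∘ₗ entryIncl θ i k
        = TensorProduct.map (entryIncl θ i k) LinearMap.id ∘ₗ ρ :=
      LinearMap.ext fun a => matrixCoaction_entryIncl θ i k a
    rw [TensorProduct.map_map, h, ← LinearMap.comp_id LinearMap.id, ← TensorProduct.map_map,
      LinearMap.comp_id, hρ.coassoc, map_map_assoc_symm, TensorProduct.map_map,
      TensorProduct.map_map]
    rfl

variable {H : Type u} [Ring H] [Algebra ℂ H] [StarRing H] [StarModule ℂ H]
  [FiniteDimensional ℂ H]

theorem coactAct_matrixCoaction_diagIncl (dp : HopfPairData H H0) (h : H) (a : A) :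
    coactAct dp (matrixCoaction θ ρ) h (diagIncl θ a) = diagIncl θ (coactAct dp ρ h a) := by
  simp only [coactAct, diagIncl_apply, map_sum, matrixCoaction_entryIncl, appRight_map]

theorem RohlinProperty.matrixCoaction {dp : HopfPairData H H0} (hρ : RohlinProperty dp ρ) :
    RohlinProperty dp (matrixCoaction θ ρ) := by
  obtain ⟨p, ⟨M, hM⟩, hstar, hidem, hcomm, hhaar⟩ := hρ
  have hlim : ∀ {E : Type u} [NormedAddCommGroup E] {f : A → E}, Continuous f → f 0 = 0 →
      ∀ {x : ℕ → A}, Tendsto (fun n => ‖x n‖) atTop (𝓝 0) →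
        Tendsto (fun n => ‖f (x n)‖) atTop (𝓝 0) := by
    intro E _ f hf hf0 x hx
    rw [← tendsto_zero_iff_norm_tendsto_zero] at hx ⊢
    exact hf0 ▸ (hf.tendsto 0).comp hx
  have hdiag : ∀ {x : ℕ → A}, Tendsto (fun n => ‖x n‖) atTop (𝓝 0) →
      Tendsto (fun n => ‖diagIncl θ (x n)‖) atTop (𝓝 0) :=
    hlim (continuous_diagIncl θ) (map_zero _)
  refine ⟨fun n => diagIncl θ (p n), ⟨M, fun n => ?_⟩, ?_, ?_, fun b => ?_, ?_⟩
  · exact (NonUnitalStarAlgHom.norm_apply_le (diagIncl θ) (p n)).trans (hM n)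
  · simpa only [map_sub, map_star] using hdiag hstar
  · simpa only [map_sub, map_mul] using hdiag hidem
  · simp only [diagIncl_commutator]
    rw [← tendsto_zero_iff_norm_tendsto_zero,
      ← Finset.sum_const_zero (s := (Finset.univ : Finset (Fin r)))]
    refine tendsto_finsetSum _ fun i _ => ?_
    rw [← Finset.sum_const_zero (s := (Finset.univ : Finset (Fin r)))]
    refine tendsto_finsetSum _ fun k _ => ?_
    rw [tendsto_zero_iff_norm_tendsto_zero]
    exact hlim (continuous_entryIncl θ i k) (map_zero _) (hcomm _)
  · simp only [coactAct_matrixCoaction_diagIncl]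
    simpa only [map_sub, map_smul, map_one] using hdiag hhaar

end MatrixCoaction

/-- Let `H` be a finite dimensional C*-Hopf algebra of dimension `N` with
dual `H0`, let `A` be a UHF-algebra of type `N^∞` (i.e. `A` has an increasing sequence of
unital ⋆-subalgebras `F k ≅ M_{N^k}(ℂ)` with dense union), and suppose `ρ` is a coaction of
`H0` on `A` with the Rohlin property.  Then for every unital C*-algebra `B` that is strongly
Morita equivalent to `A` there is a coaction `σ` of `H0` on `B` with the Rohlin property. -/
theorem uhf_morita_rohlin_coaction
    {H H0 : Type u} [CStarAlgebra H] [StarModule ℂ H] [FiniteDimensional ℂ H]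
    [CStarAlgebra H0] [StarModule ℂ H0] [FiniteDimensional ℂ H0]
    {A : Type u} [CStarAlgebra A] [StarModule ℂ A]
    (dp : HopfPairData H H0)
    (hUHF : ∃ F : ℕ → StarSubalgebra ℂ A, Monotone F ∧
      (∀ k, Nonempty
        ((F k) ≃⋆ₐ[ℂ]
          Matrix (Fin ((Module.finrank ℂ H) ^ k)) (Fin ((Module.finrank ℂ H) ^ k)) ℂ)) ∧
      (⨆ k, F k).topologicalClosure = ⊤)
    (ρ : A →ₗ[ℂ] A ⊗[ℂ] H0)
    (hρ : IsCoaction dp.dH0.comul.toLinearMap dp.dH0.counit.toLinearMap ρ)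
    (hRohlin : RohlinProperty dp ρ)
    (B : Type u) [CStarAlgebra B] [StarModule ℂ B]
    (hMorita : ∃ (X : Type u) (_ : AddCommGroup X) (_ : Module ℂ X) (bm : Bimod A B X),
      bm.IsEquivalence) :
    ∃ σ : B →ₗ[ℂ] B ⊗[ℂ] H0,
      IsCoaction dp.dH0.comul.toLinearMap dp.dH0.counit.toLinearMap σ ∧
      RohlinProperty dp σ := by
  let _ : PartialOrder A := CStarAlgebra.spectralOrder A
  have _ : StarOrderedRing A := CStarAlgebra.spectralOrderedRing A
  obtain ⟨F, hmono, hequiv, hdense⟩ := hUHF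
  obtain ⟨X, _, _, bm, hbm⟩ := hMorita
  obtain ⟨r, ⟨θ⟩⟩ := hbm.exists_matrix_starAlgEquiv
    (isMatrixFiltration_of_topologicalClosure_eq_top hmono hequiv hdense)
  exact ⟨matrixCoaction θ ρ, hρ.matrixCoaction θ, hRohlin.matrixCoaction θ⟩

end SMEPaper
end
end
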